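/- arXiv:2401.10077 — 6 statements merged into one kernel-verified Lean document; each statement's English description precedes it below -/
import Mathlib

section
/- Let n ≥ 3 and let H_1, …, H_n be nonzero finite-dimensional complex Hilbert spaces with H = H_1 ⊗ ⋯ ⊗ H_n. For each k ∈ {1,…,n} (indices taken cyclically mod n) let A_k be a linear operator on H supported on the pair of sites {k, k+1}. If A_k A_{k+1} = − A_{k+1} A_k for every k (including A_n A_1 = − A_1 A_n), then the trace of the product A_1 A_2 ⋯ A_n is zero; in particular, for no scalar phase is A_1 A_2 ⋯ A_n proportional to the identity operator, so the loop relation i^n A_1 A_2 ⋯ A_n = Id can never be satisfied. -/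
open scoped Classical

/-- Basis index set of the tensor product `⊗_v ℂ^{d v}` of finite-dimensional
complex Hilbert spaces `H_v = ℂ^{d v}`. -/
abbrev TIdx {V : Type*} (d : V → ℕ) := (v : V) → Fin (d v)

/-- A linear operator `M` on `⊗_v ℂ^{d v}` is supported on `S ⊆ V` if `M = m ⊗ Id`
for some operator `m` on `⊗_{v ∈ S} ℂ^{d v}`. -/
def SupportedOn {V : Type*} (d : V → ℕ) (S : Set V)
    (M : Matrix (TIdx d) (TIdx d) ℂ) : Prop :=
  ∃ m : Matrix ((v : S) → Fin (d v.1)) ((v : S) → Fin (d v.1)) ℂ,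
    ∀ x y : TIdx d, M x y =
      if ∀ v ∉ S, x v = y v then m (fun v => x v.1) (fun v => y v.1) else 0

namespace SupportedOn

variable {V : Type*} {d : V → ℕ} {S T : Set V} {M N : Matrix (TIdx d) (TIdx d) ℂ}

lemma apply_eq_zero (hM : SupportedOn d S M) {x y : TIdx d}
    (h : ¬ ∀ v ∉ S, x v = y v) : M x y = 0 := by
  obtain ⟨m, hm⟩ := hM
  rw [hm, if_neg h]

/-- The entries of an operator supported on `S` depend only on the restrictions to `S` of the
two indices and on whether the indices agree outside `S`. -/
lemma apply_congr (hM : SupportedOn d S M) {x y x' y' : TIdx d}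
    (hx : ∀ v ∈ S, x v = x' v) (hy : ∀ v ∈ S, y v = y' v)
    (h : (∀ v ∉ S, x v = y v) ↔ ∀ v ∉ S, x' v = y' v) : M x y = M x' y' := by
  obtain ⟨m, hm⟩ := hM
  have hx' : (fun v : S => x v.1) = fun v : S => x' v.1 := funext fun v => hx v.1 v.2
  have hy' : (fun v : S => y v.1) = fun v : S => y' v.1 := funext fun v => hy v.1 v.2
  simp only [hm, hx', hy', h]

variable [Fintype V] [DecidableEq V]

/-- If `M` and `N` have disjoint supports, a single intermediate index contributes to each entry
of `M * N`. -/
lemma mul_apply_of_disjoint (hM : SupportedOn d S M) (hN : SupportedOn d T N)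
    (hST : Disjoint S T) {x y z : TIdx d} (hzS : ∀ v ∈ S, z v = y v) (hzx : ∀ v ∉ S, z v = x v) :
    (M * N) x y = M x z * N z y := by
  rw [Matrix.mul_apply]
  refine Finset.sum_eq_single z (fun w _ hw => ?_) (by simp)
  by_contra hne
  obtain ⟨h1, h2⟩ := mul_ne_zero_iff.1 hne
  have h1' : ∀ v ∉ S, x v = w v := by_contra fun h => h1 (hM.apply_eq_zero h)
  have h2' : ∀ v ∉ T, w v = y v := by_contra fun h => h2 (hN.apply_eq_zero h)
  refine hw (funext fun v => ?_)
  by_cases hv : v ∈ S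
  · rw [hzS v hv, h2' v (Set.disjoint_left.1 hST hv)]
  · rw [hzx v hv, h1' v hv]

/-- Operators with disjoint supports commute. -/
lemma commute_of_disjoint (hM : SupportedOn d S M) (hN : SupportedOn d T N)
    (hST : Disjoint S T) : Commute M N := by
  ext x y
  have hTS : ∀ v ∈ T, v ∉ S := fun v hv => Set.disjoint_right.1 hST hv
  have hST' : ∀ v ∈ S, v ∉ T := fun v hv => Set.disjoint_left.1 hST hv
  rw [hM.mul_apply_of_disjoint hN hST (z := fun v => if v ∈ S then y v else x v)
      (fun v hv => if_pos hv) (fun v hv => if_neg hv),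
    hN.mul_apply_of_disjoint hM hST.symm (z := fun v => if v ∈ T then y v else x v)
      (fun v hv => if_pos hv) (fun v hv => if_neg hv), mul_comm]
  by_cases h : ∀ v, v ∉ S → v ∉ T → x v = y v
  · congr 1
    · apply hN.apply_congr <;> grind
    · apply hM.apply_congr <;> grind
  · push Not at h
    obtain ⟨v, hS, hT, hv⟩ := h
    rw [hN.apply_eq_zero (x := fun v => if v ∈ S then y v else x v),
      zero_mul, hM.apply_eq_zero (y := y), mul_zero] <;>
    grind

end SupportedOn

/-- The matrix unit `|a⟩⟨b|` acting on the tensor factor at `v`. -/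
noncomputable def siteUnit {V : Type*} (d : V → ℕ) (v : V) (a b : Fin (d v)) :
    Matrix (TIdx d) (TIdx d) ℂ := fun x y =>
  if (∀ w ∉ ({v} : Set V), x w = y w) then (if x v = a ∧ y v = b then 1 else 0) else 0

lemma supportedOn_siteUnit {V : Type*} (d : V → ℕ) (v : V) (a b : Fin (d v)) :
    SupportedOn d {v} (siteUnit d v a b) :=
  ⟨fun p q => if p ⟨v, rfl⟩ = a ∧ q ⟨v, rfl⟩ = b then 1 else 0, fun _ _ => rfl⟩

section TwoSites

variable {V : Type*} [Fintype V] [DecidableEq V] {d : V → ℕ} {i j : V}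

lemma siteUnit_mul_siteUnit_apply (hij : i ≠ j) (a b : Fin (d i)) (p q : Fin (d j))
    (x y : TIdx d) : (siteUnit d i a b * siteUnit d j p q) x y =
      if (∀ w ∉ ({i, j} : Set V), x w = y w) ∧ x i = a ∧ y i = b ∧ x j = p ∧ y j = q
      then 1 else 0 := by
  rw [(supportedOn_siteUnit d i a b).mul_apply_of_disjoint (supportedOn_siteUnit d j p q)
    (by simpa using hij) (z := Function.update x i (y i)) (by simp) (by
      intro v hv
      exact Function.update_of_ne hv _ _)]
  have h1 : ∀ w ∉ ({i} : Set V), x w = Function.update x i (y i) w :=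
    fun w hw => (Function.update_of_ne hw _ _).symm
  have h2 : (∀ w ∉ ({j} : Set V), Function.update x i (y i) w = y w) ↔
      ∀ w ∉ ({i, j} : Set V), x w = y w := by
    refine forall_congr' fun w => ?_
    by_cases hw : w = i
    · subst hw; simp
    · simp [hw]
  simp only [siteUnit, if_pos h1, h2, Function.update_self, Function.update_of_ne hij.symm]
  split_ifs <;> simp_all

/-- An operator supported on two sites is a linear combination of products of one-site
matrix units. -/
lemma SupportedOn.eq_sum_siteUnit (hij : i ≠ j) {M : Matrix (TIdx d) (TIdx d) ℂ}
    (hM : SupportedOn d {i, j} M) :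
    ∃ c : Fin (d i) → Fin (d i) → Fin (d j) → Fin (d j) → ℂ,
      M = ∑ a, ∑ b, ∑ p, ∑ q, c a b p q • (siteUnit d i a b * siteUnit d j p q) := by
  obtain ⟨m, hm⟩ := hM
  let glue (a : Fin (d i)) (p : Fin (d j)) : (v : ({i, j} : Set V)) → Fin (d v.1) := fun v =>
    if h : v.1 = i then Fin.cast (by rw [h]) a else Fin.cast (by rw [v.2.resolve_left h]) p
  have hglue (x : TIdx d) : glue (x i) (x j) = fun v : ({i, j} : Set V) => x v.1 := by
    funext ⟨v, hv⟩
    by_cases h : v = i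
    · subst h; simp [glue]
    · obtain rfl : v = j := hv.resolve_left h
      simp [glue, h]
  refine ⟨fun a b p q => m (glue a p) (glue b q), ?_⟩
  ext x y
  simp only [Matrix.sum_apply, Matrix.smul_apply, siteUnit_mul_siteUnit_apply hij, hm, smul_eq_mul,
    mul_ite, mul_one, mul_zero]
  simp only [ite_and, Finset.sum_ite_eq, Finset.mem_univ, if_true, Finset.sum_ite_irrel,
    Finset.sum_const_zero, hglue]
  congr

/-- If `X` and `Y` have supports `{i, j}` and `T` with `i ∉ T`, and `P` commutes with the operators
at `j`, then `X` and `Y` may be exchanged under the trace against `P`. -/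
lemma trace_mul_mul_comm_of_supportedOn (hij : i ≠ j) {T : Set V} (hiT : i ∉ T)
    {X Y P : Matrix (TIdx d) (TIdx d) ℂ}
    (hX : SupportedOn d {i, j} X) (hY : SupportedOn d T Y)
    (hP : ∀ R, SupportedOn d {j} R → Commute R P) :
    (X * (Y * P)).trace = (Y * (X * P)).trace := by
  obtain ⟨c, rfl⟩ := hX.eq_sum_siteUnit hij
  simp only [Finset.sum_mul, Finset.mul_sum, Matrix.trace_sum, Matrix.smul_mul, Matrix.mul_smul,
    Matrix.trace_smul]
  refine Finset.sum_congr rfl fun a _ => Finset.sum_congr rfl fun b _ =>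
    Finset.sum_congr rfl fun p _ => Finset.sum_congr rfl fun q _ => congrArg _ ?_
  have hL := supportedOn_siteUnit d i a b
  have hR := supportedOn_siteUnit d j p q
  have hLR := (hL.commute_of_disjoint hR (by simpa using hij)).eq
  have hLY := (hL.commute_of_disjoint hY (by simpa using hiT)).eq
  have hRP := (hP _ hR).eq
  generalize siteUnit d i a b = L at *
  generalize siteUnit d j p q = R at *
  calc (L * R * (Y * P)).trace = (R * (L * Y * P)).trace := by rw [hLR]; simp only [mul_assoc]
    _ = (L * Y * P * R).trace := Matrix.trace_mul_comm _ _
    _ = (Y * (L * R * P)).trace := by rw [hLY]; simp only [mul_assoc, hRP]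

end TwoSites

/-- if `A_k` (for `k` ranging cyclically over `Fin n`, `n ≥ 3`) is
supported on the pair of sites `{k, k+1}` and consecutive operators anticommute
(cyclically), then the ordered product `A_0 A_1 ⋯ A_{n-1}` has zero trace; in
particular it is not proportional to the identity by any nonzero scalar, so the
loop relation `i^n A_0 ⋯ A_{n-1} = 1` cannot hold. -/
theorem trace_cyclic_anticommuting_twolocal_product_eq_zero
    (n : ℕ) (hn : 3 ≤ n) [NeZero n]
    (d : Fin n → ℕ) (hd : ∀ v, 0 < d v)
    (A : Fin n → Matrix (TIdx d) (TIdx d) ℂ)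
    (hsupp : ∀ k : Fin n, SupportedOn d {k, k + 1} (A k))
    (hanti : ∀ k : Fin n, A k * A (k + 1) = -(A (k + 1) * A k)) :
    Matrix.trace (List.ofFn A).prod = 0 ∧
      (∀ c : ℂ, c ≠ 0 → (List.ofFn A).prod ≠ c • (1 : Matrix (TIdx d) (TIdx d) ℂ)) ∧
      Complex.I ^ n • (List.ofFn A).prod ≠ 1 := by
  have htr : Matrix.trace (List.ofFn A).prod = 0 := by
    obtain ⟨m, rfl⟩ : ∃ m, n = m + 3 := ⟨n - 3, by omega⟩
    have h01 : (0 : Fin (m + 3)) + 1 = 1 := zero_add 1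
    rw [List.ofFn_succ, List.ofFn_succ, List.prod_cons, List.prod_cons]
    have hX := hsupp 0
    have hXY := hanti 0
    rw [h01] at hX hXY
    have key := trace_mul_mul_comm_of_supportedOn (i := 0) (j := 1) (by simp) (T := {1, 1 + 1})
      (by simp [Fin.ext_iff, Fin.val_add, Nat.mod_eq_of_lt]) hX (hsupp 1)
      (P := (List.ofFn fun k : Fin (m + 1) => A k.succ.succ).prod) (fun R hR => by
        refine Commute.list_prod_right _ _ fun B hB => ?_
        obtain ⟨k, rfl⟩ := (List.mem_ofFn' _ _).1 hB
        refine hR.commute_of_disjoint (hsupp _) ?_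
        rw [Set.disjoint_singleton_left]
        rintro (h | h)
        · exact Fin.succ_ne_zero k (Fin.succ_injective _ (Fin.succ_zero_eq_one.trans h)).symm
        · exact Fin.succ_ne_zero k.succ (add_right_cancel ((zero_add 1).trans h)).symm)
    rw [← mul_assoc, ← mul_assoc, hXY, neg_mul, Matrix.trace_neg] at key
    have hzero := self_eq_neg.1 key.symm
    change (A 0 * (A 1 * (List.ofFn fun k : Fin (m + 1) => A k.succ.succ).prod)).trace = 0
    rw [← mul_assoc, hXY, neg_mul, Matrix.trace_neg, hzero, neg_zero]
  have hone : (1 : Matrix (TIdx d) (TIdx d) ℂ).trace ≠ 0 := by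
    have : Nonempty (TIdx d) := ⟨fun v => ⟨0, hd v⟩⟩
    rw [Matrix.trace_one]
    exact Nat.cast_ne_zero.2 Fintype.card_ne_zero
  refine ⟨htr, fun c hc h => ?_, fun h => ?_⟩
  · rw [h, Matrix.trace_smul, smul_eq_mul] at htr
    exact mul_ne_zero hc hone htr
  · rw [← h, Matrix.trace_smul, htr, smul_zero] at hone
    exact hone rfl
end

section
/- Theorem 1 (No local encodings for cyclic graphs): Let G = (V,E) be a finite connected simple graph. Then G admits a local encoding of its local fermionic modes if and only if G is a tree, i.e. G contains no cycle. -/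
open scoped Classical

/-- Kronecker delta of two vertices, as a natural number exponent. -/
def kdelta {V : Type*} [DecidableEq V] (a b : V) : ℕ := if a = b then 1 else 0

/-- A local encoding of the local fermionic modes on a graph `G`: Hermitian
operators `B k` supported on `{k}`, Hermitian operators `A j k = - A k j`
supported on `{j, k}` for edges `(j,k)`, satisfying the (anti)commutation
relations of the fermionic generators, the involution relations, and the
loop relation `i^n A_{j₁j₂} A_{j₂j₃} ⋯ A_{jₙj₁} = 1` for every closed walk. -/
def IsLocalEncoding {V : Type*} [Fintype V] [DecidableEq V] (G : SimpleGraph V)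
    (d : V → ℕ)
    (A : V → V → Matrix (TIdx d) (TIdx d) ℂ)
    (B : V → Matrix (TIdx d) (TIdx d) ℂ) : Prop :=
  (∀ k, (B k).IsHermitian ∧ SupportedOn d {k} (B k)) ∧
  (∀ j k, G.Adj j k →
      (A j k).IsHermitian ∧ SupportedOn d {j, k} (A j k) ∧ A k j = - A j k) ∧
  (∀ j k, B j * B k = B k * B j) ∧
  (∀ j k l, G.Adj j k →
      A j k * B l = ((-1 : ℂ) ^ (kdelta j l + kdelta k l)) • (B l * A j k)) ∧
  (∀ j k l m, G.Adj j k → G.Adj l m →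
      A j k * A l m =
        ((-1 : ℂ) ^ (kdelta j l + kdelta k l + kdelta j m + kdelta k m)) •
          (A l m * A j k)) ∧
  (∀ j k, G.Adj j k → A j k ^ 2 = 1) ∧
  (∀ k, B k ^ 2 = 1) ∧
  (∀ (n : ℕ) (f : Fin (n + 1) → V), (∀ t, G.Adj (f t) (f (t + 1))) →
      Complex.I ^ (n + 1) •
        (List.ofFn (fun t : Fin (n + 1) => A (f t) (f (t + 1)))).prod = 1)

section Support

variable {V : Type*} {d : V → ℕ} {S T : Set V} {M N : Matrix (TIdx d) (TIdx d) ℂ}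

theorem SupportedOn.apply_eq_zero_s1 (hM : SupportedOn d S M) {x y : TIdx d} {k : V} (hk : k ∉ S)
    (hxy : x k ≠ y k) : M x y = 0 := by
  obtain ⟨m, hm⟩ := hM
  rw [hm, if_neg fun h => hxy (h k hk)]

theorem SupportedOn.apply_congr_s1 (hM : SupportedOn d S M) {x y x' y' : TIdx d}
    (hx : ∀ k ∈ S, x k = x' k) (hy : ∀ k ∈ S, y k = y' k)
    (hxy : ∀ k ∉ S, x k = y k) (hxy' : ∀ k ∉ S, x' k = y' k) : M x y = M x' y' := by
  obtain ⟨m, hm⟩ := hM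
  rw [hm, hm, if_pos hxy, if_pos hxy']
  congr 1
  · funext k
    exact hx k k.2
  · funext k
    exact hy k k.2

theorem supportedOn_univ (M : Matrix (TIdx d) (TIdx d) ℂ) : SupportedOn d Set.univ M :=
  ⟨fun x y => M (fun v => x ⟨v, trivial⟩) (fun v => y ⟨v, trivial⟩), by simp⟩

variable [Fintype V] [DecidableEq V]

/-- If the supports of `M` and `N` meet at most in `v`, the intermediate index in the product
`M * N` is free only at `v`. -/
theorem SupportedOn.mul_apply (hM : SupportedOn d S M) (hN : SupportedOn d T N) {v : V}
    (hv : ∀ k ∈ S, k ∈ T → k = v) {x z y₀ : TIdx d}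
    (hz : ∀ k ∈ S, k ≠ v → y₀ k = z k) (hx : ∀ k ∉ S, k ≠ v → y₀ k = x k) :
    (M * N) x z = ∑ s, M x (Function.update y₀ v s) * N (Function.update y₀ v s) z := by
  rw [Matrix.mul_apply]
  symm
  refine Fintype.sum_of_injective (Function.update y₀ v) (Function.update_injective y₀ v) _ _
    (fun y hy => ?_) (fun _ => rfl)
  by_contra hne
  apply hy
  refine ⟨y v, ?_⟩
  funext k
  by_cases hk : k = v
  · subst hk; simp
  rw [Function.update_of_ne hk]
  by_cases hS : k ∈ S
  · rw [hz k hS hk]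
    by_contra h
    exact hne (by rw [hN.apply_eq_zero_s1 (fun hT => hk (hv k hS hT)) (Ne.symm h), mul_zero])
  · rw [hx k hS hk]
    by_contra h
    exact hne (by rw [hM.apply_eq_zero_s1 hS h, zero_mul])

/-- The partial trace over the site `v` is cyclic for two operators whose supports
meet at most in `v`. -/
theorem SupportedOn.sum_mul_comm (hM : SupportedOn d S M) (hN : SupportedOn d T N) {v : V}
    (hvS : v ∈ S) (hvT : v ∈ T) (hv : ∀ k ∈ S, k ∈ T → k = v) (x z : TIdx d) :
    ∑ t, (M * N) (Function.update x v t) (Function.update z v t) =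
      ∑ t, (N * M) (Function.update x v t) (Function.update z v t) := by
  have hl (t) := hM.mul_apply hN hv (x := Function.update x v t) (z := Function.update z v t)
    (y₀ := fun k => if k ∈ S then z k else x k) (by simp +contextual) (by simp +contextual)
  have hr (t) := hN.mul_apply hM (fun k h h' => hv k h' h)
    (x := Function.update x v t) (z := Function.update z v t)
    (y₀ := fun k => if k ∈ T then z k else x k) (by simp +contextual) (by simp +contextual)
  simp_rw [hl, hr]
  rw [Finset.sum_comm]
  refine Finset.sum_congr rfl fun s _ => Finset.sum_congr rfl fun t _ => ?_
  by_cases hxz : ∀ k, k ∉ S → k ∉ T → x k = z k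
  · rw [mul_comm]
    congr 1
    · apply hN.apply_congr_s1 <;> intro k hk <;> by_cases hkv : k = v <;> grind
    · apply hM.apply_congr_s1 <;> intro k hk <;> by_cases hkv : k = v <;> grind
  · push Not at hxz
    obtain ⟨k, hkS, hkT, hk⟩ := hxz
    have hkv : k ≠ v := fun h => hkS (h ▸ hvS)
    have hN₀ : N (Function.update (fun k => if k ∈ S then z k else x k) v s)
        (Function.update z v t) = 0 := hN.apply_eq_zero_s1 hkT (by simpa [hkv, hkS] using hk)
    have hM₀ : M (Function.update (fun k => if k ∈ T then z k else x k) v t)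
        (Function.update z v s) = 0 := hM.apply_eq_zero_s1 hkS (by simpa [hkv, hkT] using hk)
    rw [hN₀, hM₀, mul_zero, mul_zero]

end Support

section SiteOp

variable {V : Type*} {d : V → ℕ}

/-- The operator `a` acting on the tensor factor at `v`. -/
noncomputable def siteOp (v : V) (a : Matrix (Fin (d v)) (Fin (d v)) ℂ) :
    Matrix (TIdx d) (TIdx d) ℂ :=
  fun x y => if ∀ k ≠ v, x k = y k then a (x v) (y v) else 0

theorem siteOp_supportedOn (v : V) (a : Matrix (Fin (d v)) (Fin (d v)) ℂ) :
    SupportedOn d {v} (siteOp v a) :=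
  ⟨fun x y => a (x ⟨v, rfl⟩) (y ⟨v, rfl⟩), fun x y => by simp [siteOp]⟩

theorem siteOp_isHermitian {v : V} {a : Matrix (Fin (d v)) (Fin (d v)) ℂ} (ha : a.IsHermitian) :
    (siteOp v a : Matrix (TIdx d) (TIdx d) ℂ).IsHermitian := by
  ext x y
  rw [Matrix.conjTranspose_apply]
  by_cases h : ∀ k ≠ v, x k = y k
  · have h' : ∀ k ≠ v, y k = x k := fun k hk => (h k hk).symm
    simp only [siteOp, if_pos h, if_pos h']
    exact ha.apply _ _
  · have h' : ¬ ∀ k ≠ v, y k = x k := fun h' => h fun k hk => (h' k hk).symm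
    simp only [siteOp, if_neg h, if_neg h', star_zero]

theorem siteOp_neg (v : V) (a : Matrix (Fin (d v)) (Fin (d v)) ℂ) :
    (siteOp v (-a) : Matrix (TIdx d) (TIdx d) ℂ) = -siteOp v a := by
  ext x y
  simp only [siteOp, Matrix.neg_apply]
  split_ifs <;> simp

variable [Fintype V] [DecidableEq V]

theorem siteOp_one (v : V) : (siteOp v 1 : Matrix (TIdx d) (TIdx d) ℂ) = 1 := by
  ext x y
  rw [Matrix.one_apply, siteOp, Matrix.one_apply]
  by_cases h : x = y
  · simp [h]
  · have : ¬((∀ k ≠ v, x k = y k) ∧ x v = y v) := fun h' =>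
      h (funext fun k => if hk : k = v then hk ▸ h'.2 else h'.1 k hk)
    rw [if_neg h]
    split_ifs <;> tauto

theorem siteOp_mul_apply (v : V) (a : Matrix (Fin (d v)) (Fin (d v)) ℂ)
    (M : Matrix (TIdx d) (TIdx d) ℂ) (x z : TIdx d) :
    (siteOp v a * M) x z = ∑ t, a (x v) t * M (Function.update x v t) z := by
  rw [(siteOp_supportedOn v a).mul_apply (supportedOn_univ M) (v := v) (y₀ := x)
    (by simp) (by simp) (by simp)]
  refine Finset.sum_congr rfl fun t _ => ?_
  simp +contextual [siteOp]

theorem mul_siteOp_apply (v : V) (a : Matrix (Fin (d v)) (Fin (d v)) ℂ)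
    (M : Matrix (TIdx d) (TIdx d) ℂ) (x z : TIdx d) :
    (M * siteOp v a) x z = ∑ t, M x (Function.update z v t) * a t (z v) := by
  rw [(supportedOn_univ M).mul_apply (siteOp_supportedOn v a) (v := v) (y₀ := z)
    (by simp) (by simp) (by simp)]
  refine Finset.sum_congr rfl fun t _ => ?_
  simp +contextual [siteOp]

theorem siteOp_mul (v : V) (a b : Matrix (Fin (d v)) (Fin (d v)) ℂ) :
    (siteOp v (a * b) : Matrix (TIdx d) (TIdx d) ℂ) = siteOp v a * siteOp v b := by
  ext x z
  rw [siteOp_mul_apply, siteOp, Matrix.mul_apply]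
  split_ifs with h
  · refine Finset.sum_congr rfl fun t _ => ?_
    simp +contextual [siteOp, h]
  · refine (Finset.sum_eq_zero fun t _ => ?_).symm
    rw [siteOp, if_neg, mul_zero]
    exact fun h' => h fun k hk => by simpa [hk] using h' k hk

theorem SupportedOn.commute_siteOp {S : Set V} {M : Matrix (TIdx d) (TIdx d) ℂ}
    (hM : SupportedOn d S M) {v : V} (hv : v ∉ S) (a : Matrix (Fin (d v)) (Fin (d v)) ℂ) :
    Commute M (siteOp v a) := by
  ext x z
  rw [siteOp_mul_apply, mul_siteOp_apply, Finset.sum_eq_single (x v), Finset.sum_eq_single (z v),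
    mul_comm]
  · congr 1
    by_cases h : ∀ k ∉ S, k ≠ v → x k = z k
    · apply hM.apply_congr_s1 <;> intro k hk <;> by_cases hkv : k = v <;> grind
    · push Not at h
      obtain ⟨k, hk, hkv, hne⟩ := h
      rw [hM.apply_eq_zero_s1 hk (by simpa [hkv] using hne),
        hM.apply_eq_zero_s1 hk (by simpa [hkv] using hne)]
  · intro t _ ht
    rw [hM.apply_eq_zero_s1 hv (by simpa using ht), mul_zero]
  · simp
  · intro t _ ht
    rw [hM.apply_eq_zero_s1 hv (by simpa using ht.symm), zero_mul]
  · simp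

theorem siteOp_commute {j k : V} (hjk : j ≠ k) (a : Matrix (Fin (d j)) (Fin (d j)) ℂ)
    (b : Matrix (Fin (d k)) (Fin (d k)) ℂ) :
    Commute (siteOp j a : Matrix (TIdx d) (TIdx d) ℂ) (siteOp k b) :=
  (siteOp_supportedOn j a).commute_siteOp (by simpa using hjk.symm) b

theorem siteOp_mul_siteOp_supportedOn {j k : V} (hjk : j ≠ k)
    (a : Matrix (Fin (d j)) (Fin (d j)) ℂ) (b : Matrix (Fin (d k)) (Fin (d k)) ℂ) :
    SupportedOn d {j, k} (siteOp j a * siteOp k b) := by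
  refine ⟨fun x y => a (x ⟨j, by simp⟩) (y ⟨j, by simp⟩) * b (x ⟨k, by simp⟩) (y ⟨k, by simp⟩),
    fun x z => ?_⟩
  rw [siteOp_mul_apply, Finset.sum_eq_single (z j)]
  · by_cases h : ∀ l ∉ ({j, k} : Set V), x l = z l
    · rw [if_pos h, siteOp, if_pos]
      · simp [hjk.symm]
      · intro l hl
        by_cases hlj : l = j
        · subst hlj; simp
        · simpa [hlj] using h l (by simp [hl, hlj])
    · rw [if_neg h, siteOp, if_neg, mul_zero]
      intro h'
      refine h fun l hl => ?_
      simp only [Set.mem_insert_iff, Set.mem_singleton_iff, not_or] at hl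
      simpa [hl.1] using h' l hl.2
  · intro t _ ht
    rw [siteOp, if_neg, mul_zero]
    exact fun h => ht (by simpa using h j hjk)
  · simp

/-- An operator commuting with the full matrix algebra at `v` is diagonal at `v`. -/
theorem apply_eq_zero_of_commute_siteOp {M : Matrix (TIdx d) (TIdx d) ℂ} {v : V}
    (hM : ∀ a, Commute M (siteOp v a)) {x z : TIdx d} (hxz : x v ≠ z v) : M x z = 0 := by
  have h := congrFun (congrFun (hM (Matrix.single (x v) (x v) 1)).eq x) z
  rw [siteOp_mul_apply, mul_siteOp_apply] at h
  simpa [Matrix.single_apply, hxz] using h.symm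

theorem apply_update_of_commute_siteOp {M : Matrix (TIdx d) (TIdx d) ℂ} {v : V}
    (hM : ∀ a, Commute M (siteOp v a)) {x z : TIdx d} (hxz : x v = z v) (t : Fin (d v)) :
    M (Function.update x v t) (Function.update z v t) = M x z := by
  have h := congrFun (congrFun (hM (Matrix.single (x v) t 1)).eq x) (Function.update z v t)
  rw [siteOp_mul_apply, mul_siteOp_apply] at h
  simpa [Matrix.single_apply, hxz] using h.symm

/-- The product of two anticommuting operators whose supports meet exactly in `v` cannot
commute with the full matrix algebra at `v`, unless it vanishes. -/
theorem SupportedOn.mul_eq_zero_of_anticommute {S T : Set V} {M N : Matrix (TIdx d) (TIdx d) ℂ}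
    (hM : SupportedOn d S M) (hN : SupportedOn d T N) {v : V} (hd : 0 < d v)
    (hvS : v ∈ S) (hvT : v ∈ T) (hv : ∀ k ∈ S, k ∈ T → k = v) (hMN : M * N = -(N * M))
    (hcomm : ∀ a, Commute (M * N) (siteOp v a)) : M * N = 0 := by
  ext x z
  by_cases hxz : x v = z v
  · have h := hM.sum_mul_comm hN hvS hvT hv x z
    rw [← neg_eq_iff_eq_neg] at hMN
    rw [← hMN] at h
    simp only [Matrix.neg_apply, apply_update_of_commute_siteOp hcomm hxz, Finset.sum_const,
      Finset.card_univ, Fintype.card_fin, nsmul_eq_mul] at h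
    have hd' : (d v : ℂ) ≠ 0 := by exact_mod_cast hd.ne'
    have h' := mul_left_cancel₀ hd' h
    simpa using self_eq_neg.mp h'
  · exact apply_eq_zero_of_commute_siteOp hcomm hxz

end SiteOp

section WalkProd

variable {V : Type*} {G : SimpleGraph V} {R : Type*} [Monoid R]

/-- The ordered product of the edge labels along a walk. -/
def walkProd (A : V → V → R) {u v : V} : G.Walk u v → R
  | .nil => 1
  | .cons (u := u) (v := w) _ p => A u w * walkProd A p

theorem walkProd_append (A : V → V → R) {u v w : V} (p : G.Walk u v) (q : G.Walk v w) :
    walkProd A (p.append q) = walkProd A p * walkProd A q := by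
  induction p with
  | nil => simp [walkProd]
  | cons h p ih => simp [walkProd, ih, mul_assoc]

theorem walkProd_eq_ofFn_prod (A : V → V → R) {u v : V} (p : G.Walk u v) :
    walkProd A p =
      (List.ofFn fun t : Fin p.length => A (p.getVert t) (p.getVert (t + 1))).prod := by
  induction p with
  | nil => simp [walkProd]
  | cons h p ih => simp [walkProd, ih, List.ofFn_succ]

theorem exists_walkProd_eq_ofFn_prod (A : V → V → R) (m : ℕ) (g : ℕ → V)
    (hg : ∀ i, G.Adj (g i) (g (i + 1))) :
    ∃ p : G.Walk (g 0) (g m),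
      walkProd A p = (List.ofFn fun t : Fin m => A (g t) (g (t + 1))).prod := by
  induction m generalizing g with
  | zero => exact ⟨.nil, by simp [walkProd]⟩
  | succ m ih =>
    obtain ⟨p, hp⟩ := ih (fun i => g (i + 1)) fun i => hg (i + 1)
    exact ⟨.cons (hg 0) p, by simp [walkProd, hp, List.ofFn_succ]⟩

/-- In an acyclic graph with edge labels inverse under reversal, the product along a walk
is unchanged by reducing the walk to a path. -/
theorem walkProd_bypass [DecidableEq V] (hG : G.IsAcyclic) (A : V → V → R)
    (hA : ∀ u v, G.Adj u v → A u v * A v u = 1) {u v : V} (p : G.Walk u v) :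
    walkProd A p.bypass = walkProd A p := by
  induction p with
  | nil => rfl
  | @cons u v w h p ih =>
    rw [SimpleGraph.Walk.bypass]
    split_ifs with hs
    · have hq : p.bypass.takeUntil u hs = .cons h.symm .nil :=
        congrArg Subtype.val ((hG.subsingleton_path v u).elim ⟨_, p.bypass_isPath.takeUntil hs⟩
          ⟨.cons h.symm .nil, by simp [h.ne']⟩)
      have happ := congrArg (walkProd A) (p.bypass.take_spec hs)
      rw [walkProd_append, hq, ih] at happ
      simp only [walkProd, mul_one] at happ ⊢
      rw [← happ, ← mul_assoc, hA u v h, one_mul]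
    · simp [walkProd, ih]

theorem walkProd_eq_one_of_isAcyclic (hG : G.IsAcyclic) (A : V → V → R)
    (hA : ∀ u v, G.Adj u v → A u v * A v u = 1) {u v : V} (huv : u = v) (p : G.Walk u v) :
    walkProd A p = 1 := by
  classical
  subst huv
  rw [← walkProd_bypass hG A hA, 
    (SimpleGraph.Walk.isPath_iff_nil.mp p.bypass_isPath).eq_nil]
  rfl

end WalkProd

theorem List.ofFn_smul_prod {R : Type*} [Ring R] [Algebra ℂ R] (c : ℂ) {n : ℕ} (M : Fin n → R) :
    (List.ofFn fun t => c • M t).prod = c ^ n • (List.ofFn M).prod := by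
  induction n with
  | zero => simp
  | succ n ih => simp [List.ofFn_succ, ih, smul_smul, pow_succ]

open scoped Kronecker in
/-- There are arbitrarily many pairwise anticommuting Hermitian involutions on some nonzero
finite-dimensional Hilbert space. -/
theorem exists_anticommuting_involutions_fin (n : ℕ) :
    ∃ N : ℕ, 0 < N ∧ ∃ g : Fin n → Matrix (Fin N) (Fin N) ℂ,
      (∀ i, (g i).IsHermitian) ∧ (∀ i, g i * g i = 1) ∧
        ∀ i j, i ≠ j → g i * g j = -(g j * g i) := by
  induction n with
  | zero => exact ⟨1, one_pos, fun i => i.elim0, fun i => i.elim0, fun i => i.elim0,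
      fun i => i.elim0⟩
  | succ n ih =>
    obtain ⟨N, hN, g, hH, hS, hC⟩ := ih
    let X : Matrix (Fin 2) (Fin 2) ℂ := !![0, 1; 1, 0]
    let Z : Matrix (Fin 2) (Fin 2) ℂ := !![1, 0; 0, -1]
    have hXH : X.conjTranspose = X := by
      ext i j; fin_cases i <;> fin_cases j <;> simp [X]
    have hZH : Z.conjTranspose = Z := by
      ext i j; fin_cases i <;> fin_cases j <;> simp [Z]
    have hXX : X * X = 1 := by
      ext i j; fin_cases i <;> fin_cases j <;> simp [X]
    have hZZ : Z * Z = 1 := by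
      ext i j; fin_cases i <;> fin_cases j <;> simp [Z]
    have hXZ : X * Z = -(Z * X) := by
      ext i j; fin_cases i <;> fin_cases j <;> simp [X, Z]
    let e : Fin N × Fin 2 ≃ Fin (N * 2) := finProdFinEquiv
    let φ := Matrix.reindexAlgEquiv ℂ ℂ e
    have hφ (a : Matrix (Fin N × Fin 2) (Fin N × Fin 2) ℂ) (ha : a.conjTranspose = a) :
        (φ a).IsHermitian := by
      change (Matrix.reindex e e a).conjTranspose = Matrix.reindex e e a
      rw [Matrix.conjTranspose_reindex, ha]
    have hneg (a : Matrix (Fin N) (Fin N) ℂ) (b : Matrix (Fin 2) (Fin 2) ℂ) :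
        a ⊗ₖ (-b) = -a ⊗ₖ b := by
      ext; simp
    have hneg' (a : Matrix (Fin N) (Fin N) ℂ) (b : Matrix (Fin 2) (Fin 2) ℂ) :
        (-a) ⊗ₖ b = -a ⊗ₖ b := by
      ext; simp
    refine ⟨N * 2, by positivity,
      Fin.cons (φ (1 ⊗ₖ X)) fun i => φ ((g i) ⊗ₖ Z), ?_, ?_, ?_⟩
    · intro i
      refine Fin.cases ?_ (fun i => ?_) i
      · exact hφ _ (by rw [Matrix.conjTranspose_kronecker, hXH, Matrix.conjTranspose_one])
      · exact hφ _ (by rw [Matrix.conjTranspose_kronecker, hZH, (hH i).eq])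
    · intro i
      refine Fin.cases ?_ (fun i => ?_) i
      · simp only [Fin.cons_zero]
        rw [← map_mul, ← Matrix.mul_kronecker_mul, hXX, one_mul, Matrix.one_kronecker_one, map_one]
      · simp only [Fin.cons_succ]
        rw [← map_mul, ← Matrix.mul_kronecker_mul, hZZ, hS, Matrix.one_kronecker_one, map_one]
    · intro i j
      refine Fin.cases ?_ (fun i => ?_) i <;> refine Fin.cases ?_ (fun j => ?_) j
      · simp
      · intro _
        simp only [Fin.cons_zero, Fin.cons_succ]
        rw [← map_mul, ← map_mul, ← map_neg, ← Matrix.mul_kronecker_mul,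
          ← Matrix.mul_kronecker_mul, hXZ, hneg, one_mul, mul_one]
      · intro _
        simp only [Fin.cons_zero, Fin.cons_succ]
        rw [← map_mul, ← map_mul, ← map_neg, ← Matrix.mul_kronecker_mul,
          ← Matrix.mul_kronecker_mul, hXZ, hneg, neg_neg, one_mul, mul_one]
      · intro hij
        simp only [Fin.cons_succ]
        rw [← map_mul, ← map_mul, ← map_neg, ← Matrix.mul_kronecker_mul,
          ← Matrix.mul_kronecker_mul, hC i j (fun h => hij (h ▸ rfl)), hneg']

theorem exists_anticommuting_involutions (ι : Type*) [Finite ι] :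
    ∃ N : ℕ, 0 < N ∧ ∃ g : ι → Matrix (Fin N) (Fin N) ℂ,
      (∀ i, (g i).IsHermitian) ∧ (∀ i, g i * g i = 1) ∧
        ∀ i j, i ≠ j → g i * g j = -(g j * g i) := by
  obtain ⟨n, ⟨e⟩⟩ := Finite.exists_equiv_fin ι
  obtain ⟨N, hN, g, hH, hS, hC⟩ := exists_anticommuting_involutions_fin n
  exact ⟨N, hN, g ∘ e, fun i => hH _, fun i => hS _, fun i j hij => hC _ _ (e.injective.ne hij)⟩

theorem mul_mul_eq_smul_of_left {R : Type*} [Ring R] [Algebra ℂ R] {x x' y : R} {a b : ℂ}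
    (h : x * y = a • (y * x)) (h' : x' * y = b • (y * x')) :
    x * x' * y = (a * b) • (y * (x * x')) := by
  rw [mul_assoc, h', mul_smul_comm, ← mul_assoc, h, smul_mul_assoc, smul_smul, mul_assoc,
    mul_comm b]

theorem mul_mul_eq_smul_of_right {R : Type*} [Ring R] [Algebra ℂ R] {x y y' : R} {a b : ℂ}
    (h : x * y = a • (y * x)) (h' : x * y' = b • (y' * x)) :
    x * (y * y') = (a * b) • (y * y' * x) := by
  rw [← mul_assoc, h, smul_mul_assoc, mul_assoc, h', mul_smul_comm, smul_smul, mul_assoc]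

theorem exists_antisymmetric_sign (V : Type*) :
    ∃ s : V → V → ℂ, (∀ j k, j ≠ k → s k j = -s j k) ∧ (∀ j k, s j k * s j k = 1) ∧
      ∀ j k, star (s j k) = s j k := by
  let r : V → V → Prop := WellOrderingRel
  refine ⟨fun j k => if r j k then 1 else -1, fun j k hjk => ?_, fun j k => ?_, fun j k => ?_⟩
  · rcases trichotomous_of r j k with h | h | h
    · simp [h, asymm_of r h]
    · exact absurd h hjk
    · simp [h, asymm_of r h]
  · dsimp only
    split_ifs <;> simp
  · dsimp only
    split_ifs <;> simp

theorem sign_eq_neg_one_pow_kdelta {V : Type*} [DecidableEq V]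
    {j k l m : V} (hjk : j ≠ k) (hlm : l ≠ m) :
    (if j = l ∧ k ≠ m then (-1 : ℂ) else 1) * (if j = m ∧ k ≠ l then (-1 : ℂ) else 1) *
      ((if k = l ∧ j ≠ m then (-1 : ℂ) else 1) * (if k = m ∧ j ≠ l then (-1 : ℂ) else 1)) =
      (-1 : ℂ) ^ (kdelta j l + kdelta k l + kdelta j m + kdelta k m) := by
  by_cases h₁ : j = l
  · subst h₁
    by_cases h₄ : k = m <;> simp [kdelta, h₄, hlm, hlm.symm, hjk.symm]
  by_cases h₂ : k = l
  · subst h₂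
    by_cases h₃ : j = m <;> simp [kdelta, h₁, h₃, hlm, hlm.symm]
  by_cases h₃ : j = m
  · subst h₃
    simp [kdelta, h₁, h₂, hjk.symm]
  by_cases h₄ : k = m <;> simp [kdelta, h₁, h₂, h₃, h₄, hlm.symm]

section Encoding

variable {V : Type*} [Fintype V] [DecidableEq V] {G : SimpleGraph V} {d : V → ℕ}
  {A : V → V → Matrix (TIdx d) (TIdx d) ℂ} {B : V → Matrix (TIdx d) (TIdx d) ℂ}

theorem IsLocalEncoding.walkProd_eq_one (h : IsLocalEncoding G d A B) {u : V} (p : G.Walk u u) :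
    walkProd (fun j k => Complex.I • A j k) p = 1 := by
  obtain ⟨-, -, -, -, -, -, -, hloop⟩ := h
  rw [walkProd_eq_ofFn_prod, List.ofFn_smul_prod Complex.I
    (fun t : Fin p.length => A (p.getVert t) (p.getVert (t + 1)))]
  obtain hp | ⟨n, hn⟩ : p.length = 0 ∨ ∃ n, p.length = n + 1 := by
    cases p.length <;> simp
  · generalize hl : p.length = l at *
    subst hp
    simp
  have hf (t : Fin (n + 1)) : p.getVert ((t + 1 : Fin (n + 1)) : ℕ) = p.getVert (t + 1) := by
    rw [Fin.val_add_one]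
    split_ifs with ht
    · rw [ht, Fin.val_last, ← hn, p.getVert_length, p.getVert_zero]
    · rfl
  have := hloop n (fun t => p.getVert t) fun t => by
    rw [hf]
    exact p.adj_getVert_succ (by omega)
  simp only [hf] at this
  rw [hn]
  exact this

theorem IsLocalEncoding.walkProd_commute_siteOp (h : IsLocalEncoding G d A B) {u v w : V}
    (p : G.Walk u w) (hv : v ∉ p.support) (a : Matrix (Fin (d v)) (Fin (d v)) ℂ) :
    Commute (walkProd (fun j k => Complex.I • A j k) p) (siteOp v a) := by
  induction p with
  | nil => exact Commute.one_left _
  | @cons x y z hxy p ih =>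
    rw [SimpleGraph.Walk.support_cons, List.mem_cons, not_or] at hv
    have hvy : v ≠ y := fun e => hv.2 (e ▸ p.start_mem_support)
    exact (((h.2.1 x y hxy).2.1.commute_siteOp (by simp [hv.1, hvy]) a).smul_left _).mul_left
      (ih hv.2)

theorem IsLocalEncoding.isAcyclic (h : IsLocalEncoding G d A B) (hd : ∀ v, 0 < d v) :
    G.IsAcyclic := by
  have : Nonempty (TIdx d) := ⟨fun v => ⟨0, hd v⟩⟩
  intro u c hc
  cases c with
  | nil => simp at hc
  | @cons _ v _ huv p =>
    rw [SimpleGraph.Walk.cons_isCycle_iff] at hc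
    cases p with
    | nil => exact huv.ne rfl
    | @cons _ w _ hvw q =>
      have hvq : v ∉ q.support := ((SimpleGraph.Walk.cons_isPath_iff _ _).mp hc.1).2
      have huw : u ≠ w := by
        rintro rfl
        exact hc.2 (by simp [Sym2.eq_swap])
      have hprod := h.walkProd_eq_one (.cons huv (.cons hvw q))
      simp only [walkProd, smul_mul_assoc, mul_smul_comm, smul_smul, Complex.I_mul_I] at hprod
      rw [← mul_assoc] at hprod
      set Q := walkProd (fun j k => Complex.I • A j k) q
      have hleft : (A u v * A v w) * -Q = 1 := by
        rw [← hprod]; simp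
      have hright : -Q * (A u v * A v w) = 1 := mul_eq_one_comm.mp hleft
      have hcomm (a) : Commute (A u v * A v w) (siteOp v a) := by
        have hQa : Commute (-Q) (siteOp v a) := (h.walkProd_commute_siteOp q hvq a).neg_left
        calc A u v * A v w * siteOp v a
            = A u v * A v w * (siteOp v a * -Q) * (A u v * A v w) := by
              simp only [mul_assoc] at hright ⊢
              rw [hright, mul_one]
          _ = siteOp v a * (A u v * A v w) := by
              rw [← hQa.eq, ← mul_assoc (A u v * A v w), hleft, one_mul]
      have hanti : A u v * A v w = -(A v w * A u v) := by
        have := h.2.2.2.2.1 u v v w huv hvw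
        simpa [kdelta, huv.ne, hvw.ne, huw] using this
      have hzero := (h.2.1 u v huv).2.1.mul_eq_zero_of_anticommute (h.2.1 v w hvw).2.1 (hd v)
        (by simp) (by simp) (by
          rintro k (rfl | rfl) (hk | hk)
          · exact hk
          · exact absurd hk huw
          · rfl
          · rfl) hanti hcomm
      rw [hzero, zero_mul] at hleft
      exact zero_ne_one hleft

/-- On an acyclic graph, placing at each vertex a Clifford algebra with one generator per
neighbour and one for the vertex itself gives a local encoding. -/
theorem SimpleGraph.IsAcyclic.exists_isLocalEncoding (hG : G.IsAcyclic) :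
    ∃ d : V → ℕ, (∀ v, 0 < d v) ∧
      ∃ (A : V → V → Matrix (TIdx d) (TIdx d) ℂ)
        (B : V → Matrix (TIdx d) (TIdx d) ℂ), IsLocalEncoding G d A B := by
  obtain ⟨N, hN, γ, hH, hS, hC⟩ := exists_anticommuting_involutions (Option V)
  obtain ⟨s, hs_anti, hs_sq, hs_star⟩ := exists_antisymmetric_sign V
  let d : V → ℕ := fun _ => N
  let P (v : V) (i : Option V) : Matrix (TIdx d) (TIdx d) ℂ := siteOp (d := d) v (γ i)
  have hPH (v i) : (P v i).IsHermitian := siteOp_isHermitian (hH i)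
  have hPS (v i) : P v i * P v i = 1 := by
    simp only [P]
    rw [← siteOp_mul, hS, siteOp_one]
  have hPC {v w : V} (hvw : v ≠ w) (i i') : Commute (P v i) (P w i') := siteOp_commute hvw _ _
  have hP (v i w i') : P v i * P w i' =
      (if v = w ∧ i ≠ i' then (-1 : ℂ) else 1) • (P w i' * P v i) := by
    by_cases hvw : v = w
    · subst hvw
      by_cases hi : i = i'
      · simp [hi]
      · simp only [P, hi, ne_eq, not_false_eq_true, and_self, if_true, neg_smul, one_smul]
        rw [← siteOp_mul, hC i i' hi, siteOp_neg, siteOp_mul]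
    · simpa [hvw] using (hPC hvw i i').eq
  let A (j k : V) : Matrix (TIdx d) (TIdx d) ℂ := s j k • (P j (some k) * P k (some j))
  have hA_anti (j k) (hjk : j ≠ k) : A k j = -A j k := by
    simp only [A]
    rw [hs_anti j k hjk, (hPC hjk _ _).eq, neg_smul]
  have hA_sq (j k) (hjk : j ≠ k) : A j k * A j k = 1 := by
    simp only [A]
    rw [smul_mul_smul_comm, hs_sq, one_smul, (hPC hjk.symm _ _).mul_mul_mul_comm, hPS, hPS,
      mul_one]
  refine ⟨d, fun _ => hN, A, fun v => P v none, fun k => ⟨hPH k none, siteOp_supportedOn k _⟩,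
    fun j k h => ⟨?_, ?_, hA_anti j k h.ne⟩, fun j k => ?_, fun j k l h => ?_,
    fun j k l m h h' => ?_, fun j k h => by rw [pow_two, hA_sq j k h.ne],
    fun k => by rw [pow_two, hPS], fun n f hf => ?_⟩
  · change (s j k • (P j (some k) * P k (some j))).conjTranspose = _
    rw [Matrix.conjTranspose_smul, Matrix.conjTranspose_mul, (hPH _ _).eq, (hPH _ _).eq, hs_star,
      (hPC h.ne.symm _ _).eq]
  · obtain ⟨m, hm⟩ := siteOp_mul_siteOp_supportedOn (d := d) h.ne (γ (some k)) (γ (some j))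
    refine ⟨s j k • m, fun x y => ?_⟩
    simp only [A, P, Matrix.smul_apply, hm]
    split_ifs <;> simp
  · by_cases hjk : j = k
    · rw [hjk]
    · exact (hPC hjk none none).eq
  · simp only [A]
    rw [smul_mul_assoc, mul_mul_eq_smul_of_left (hP j _ l _) (hP k _ l _), mul_smul_comm,
      smul_comm]
    congr 1
    by_cases h₁ : j = l <;> by_cases h₂ : k = l <;> simp [kdelta, h₁, h₂]
  · simp only [A]
    rw [smul_mul_smul_comm, smul_mul_smul_comm,
      mul_mul_eq_smul_of_left
        (mul_mul_eq_smul_of_right (hP j (some k) l (some m)) (hP j (some k) m (some l)))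
        (mul_mul_eq_smul_of_right (hP k (some j) l (some m)) (hP k (some j) m (some l))),
      smul_comm, mul_comm (s j k)]
    congr 1
    simpa using sign_eq_neg_one_pow_kdelta h.ne h'.ne
  · let g : ℕ → V := fun i => f (Fin.ofNat (n + 1) i)
    have hg (i : ℕ) : g (i + 1) = f (Fin.ofNat (n + 1) i + 1) := by
      simp only [g]
      congr 1
      ext
      simp [Fin.val_add]
    have hgt (t : Fin (n + 1)) : g t = f t := by simp [g]
    have hgt' (t : Fin (n + 1)) : g (t + 1) = f (t + 1) := by
      rw [hg]
      simp
    have hclosed : g (n + 1) = g 0 := by simp [g, Fin.ofNat]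
    obtain ⟨p, hp⟩ := exists_walkProd_eq_ofFn_prod (G := G) (fun j k => Complex.I • A j k) (n + 1) g
      fun i => by
        rw [hg]
        exact hf _
    have hone := walkProd_eq_one_of_isAcyclic hG (fun j k => Complex.I • A j k)
      (fun u v huv => by
        rw [hA_anti u v huv.ne, smul_mul_smul_comm, Complex.I_mul_I, mul_neg, hA_sq u v huv.ne]
        simp) hclosed.symm p
    rw [← List.ofFn_smul_prod, ← hone, hp]
    simp only [hgt, hgt']

end Encoding

/-- Theorem 1, no local encodings for cyclic graphs: a finite
connected simple graph admits a local encoding of its local fermionic modes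
(into nonzero finite-dimensional local Hilbert spaces) if and only if it is a
tree. -/
theorem localEncoding_iff_isTree {V : Type*} [Fintype V] [DecidableEq V]
    (G : SimpleGraph V) (hG : G.Connected) :
    (∃ (d : V → ℕ), (∀ v, 0 < d v) ∧
      ∃ (A : V → V → Matrix (TIdx d) (TIdx d) ℂ)
        (B : V → Matrix (TIdx d) (TIdx d) ℂ), IsLocalEncoding G d A B) ↔
    G.IsTree := by
  constructor
  · rintro ⟨d, hd, A, B, h⟩
    exact ⟨hG, h.isAcyclic hd⟩
  · intro h
    exact h.isAcyclic.exists_isLocalEncoding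
end

section
/- Core lemma for Theorem 2: Let H_Q, H_A, H_B, H_C be nonzero finite-dimensional complex Hilbert spaces, indexed by the four-element set {Q,A,B,C}, and let H = H_Q ⊗ H_A ⊗ H_B ⊗ H_C. Let q ∈ H_Q, a ∈ H_A, b ∈ H_B, c ∈ H_C be unit vectors and ψ = q ⊗ a ⊗ b ⊗ c. Let U, V, W be Hermitian operators on H supported on {Q,A}, {Q,B}, {Q,C} respectively, satisfying U² = V² = W² = Id and pairwise anticommuting: UV = −VU, UW = −WU, VW = −WV. Then it is impossible that there exist vectors φ_{AC} ∈ H_A ⊗ H_C and φ_{BC} ∈ H_B ⊗ H_C such that U W ψ equals the image of q ⊗ φ_{AC} ⊗ b under the canonical isomorphism H_Q ⊗ (H_A ⊗ H_C) ⊗ H_B ≅ H and V W ψ equals the image of q ⊗ a ⊗ φ_{BC} under the canonical isomorphism H_Q ⊗ H_A ⊗ (H_B ⊗ H_C) ≅ H. In other words, three pairwise anticommuting Hermitian involutions overlapping only on the factor Q cannot map a product state to states that remain unentangled between Q and the rest. -/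
open scoped Classical

section
variable {ιQ ιA ιB ιC : Type*} [Fintype ιQ] [Fintype ιA] [Fintype ιB] [Fintype ιC]

/-- An operator on `H_Q ⊗ H_A ⊗ H_B ⊗ H_C` supported on the factors `{Q, A}`,
i.e. of the form `u ⊗ Id_B ⊗ Id_C`. -/
def SuppQA (M : Matrix (ιQ × ιA × ιB × ιC) (ιQ × ιA × ιB × ιC) ℂ) : Prop :=
  ∃ u : Matrix (ιQ × ιA) (ιQ × ιA) ℂ, ∀ q a b c q' a' b' c',
    M (q, a, b, c) (q', a', b', c') =
      u (q, a) (q', a') * (if b = b' ∧ c = c' then 1 else 0)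

/-- An operator on `H_Q ⊗ H_A ⊗ H_B ⊗ H_C` supported on the factors `{Q, B}`. -/
def SuppQB (M : Matrix (ιQ × ιA × ιB × ιC) (ιQ × ιA × ιB × ιC) ℂ) : Prop :=
  ∃ u : Matrix (ιQ × ιB) (ιQ × ιB) ℂ, ∀ q a b c q' a' b' c',
    M (q, a, b, c) (q', a', b', c') =
      u (q, b) (q', b') * (if a = a' ∧ c = c' then 1 else 0)

/-- An operator on `H_Q ⊗ H_A ⊗ H_B ⊗ H_C` supported on the factors `{Q, C}`. -/
def SuppQC (M : Matrix (ιQ × ιA × ιB × ιC) (ιQ × ιA × ιB × ιC) ℂ) : Prop :=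
  ∃ u : Matrix (ιQ × ιC) (ιQ × ιC) ℂ, ∀ q a b c q' a' b' c',
    M (q, a, b, c) (q', a', b', c') =
      u (q, c) (q', c') * (if a = a' ∧ b = b' then 1 else 0)

end

open scoped Matrix

/-- The operator `(⟨i| ⊗ Id) u (|v⟩ ⊗ Id)` on the first factor, obtained from an operator `u` on a
twofold tensor product by inserting `v` into the second factor and reading off coordinate `i`. -/
def partialContraction {κ ι : Type*} [Fintype ι] (u : Matrix (κ × ι) (κ × ι) ℂ) (v : ι → ℂ)
    (i : ι) : Matrix κ κ ℂ :=
  fun x y => ∑ j, u (x, i) (y, j) * v j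

theorem partialContraction_eq_sum {κ ι : Type*} [Fintype ι] (u : Matrix (κ × ι) (κ × ι) ℂ)
    (v : ι → ℂ) (i : ι) :
    partialContraction u v i = ∑ j, v j • Matrix.of fun x y => u (x, i) (y, j) := by
  ext x y
  simp [partialContraction, Matrix.sum_apply, mul_comm]

/-- If all the blocks of `u` and `v` on the common first factor anticommute, so do their partial
contractions. -/
theorem partialContraction_anticomm {κ ι ι' : Type*} [Fintype κ] [Fintype ι] [Fintype ι']
    {u : Matrix (κ × ι) (κ × ι) ℂ} {v : Matrix (κ × ι') (κ × ι') ℂ}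
    (h : ∀ x y i i' j j', ∑ z, u (x, i) (z, i') * v (z, j) (y, j') =
      -∑ z, v (x, j) (z, j') * u (z, i) (y, i'))
    (f : ι → ℂ) (g : ι' → ℂ) (i : ι) (j : ι') :
    partialContraction u f i * partialContraction v g j =
      -(partialContraction v g j * partialContraction u f i) := by
  simp only [partialContraction_eq_sum, Finset.sum_mul_sum, ← Finset.sum_neg_distrib]
  rw [Finset.sum_comm]
  refine Finset.sum_congr rfl fun j' _ => Finset.sum_congr rfl fun i' _ => ?_
  rw [smul_mul_smul_comm, smul_mul_smul_comm, mul_comm (g j'), ← smul_neg]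
  congr 1
  ext x y
  simpa [Matrix.mul_apply] using h x y i i' j j'

theorem partialContraction_mulVec {κ ι : Type*} [Fintype κ] [Fintype ι]
    (u : Matrix (κ × ι) (κ × ι) ℂ) (v : ι → ℂ) (i : ι) (g : κ → ℂ) (x : κ) :
    (partialContraction u v i *ᵥ g) x = ∑ y, ∑ j, u (x, i) (y, j) * (g y * v j) := by
  simp only [Matrix.mulVec, dotProduct, partialContraction, Finset.sum_mul]
  exact Finset.sum_congr rfl fun y _ => Finset.sum_congr rfl fun j _ => by ring

/-- Let families `u i`, `v j`, `w k` of matrices anticommute between families. If every `u i * w k`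
and every `v j * w k` has the common eigenvector `q`, with eigenvalues `φ i k` and `χ j k`, then
one of the two families of eigenvalues vanishes. -/
theorem eigenvalues_eq_zero_of_anticomm {κ ι ι' ι'' : Type*} [Fintype κ]
    {u : ι → Matrix κ κ ℂ} {v : ι' → Matrix κ κ ℂ} {w : ι'' → Matrix κ κ ℂ}
    (huv : ∀ i j, u i * v j = -(v j * u i)) (huw : ∀ i k, u i * w k = -(w k * u i))
    (hvw : ∀ j k, v j * w k = -(w k * v j)) {q : κ → ℂ} (hq : q ≠ 0)
    {φ : ι → ι'' → ℂ} {χ : ι' → ι'' → ℂ}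
    (hφ : ∀ i k, (u i * w k) *ᵥ q = φ i k • q) (hχ : ∀ j k, (v j * w k) *ᵥ q = χ j k • q) :
    (∀ i k, φ i k = 0) ∨ (∀ j k, χ j k = 0) := by
  have cross : ∀ i j k l, φ i k * χ j l + φ i l * χ j k = 0 := by
    intro i j k l
    have hmat : u i * w k * (v j * w l) + v j * w k * (u i * w l) = 0 := by
      have swap_left : u i * w k * (v j * w l) = -(u i * v j * (w k * w l)) := by
        rw [← mul_assoc, mul_assoc (u i), ← neg_eq_iff_eq_neg.mpr (hvw j k)]
        noncomm_ring
      have swap_right : v j * w k * (u i * w l) = -(v j * u i * (w k * w l)) := by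
        rw [← mul_assoc, mul_assoc (v j), ← neg_eq_iff_eq_neg.mpr (huw i k)]
        noncomm_ring
      rw [swap_left, swap_right, huv]
      noncomm_ring
    have hvec := congrArg (· *ᵥ q) hmat
    simp only [Matrix.add_mulVec, ← Matrix.mulVec_mulVec _ (u i * w k),
      ← Matrix.mulVec_mulVec _ (v j * w k), hφ, hχ, Matrix.mulVec_smul, Matrix.zero_mulVec,
      smul_smul, ← add_smul] at hvec
    have := (smul_eq_zero.mp hvec).resolve_right hq
    linear_combination this
  by_contra! hne
  obtain ⟨⟨i, k, hik⟩, ⟨j, l, hjl⟩⟩ := hne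
  have hjk : χ j k = 0 := by
    have := cross i j k k
    have : φ i k * χ j k = 0 := by linear_combination this / 2
    exact (mul_eq_zero.mp this).resolve_left hik
  have := cross i j k l
  rw [hjk, mul_zero, add_zero] at this
  exact mul_ne_zero hik hjl this

theorem exists_ne_zero_of_sum_norm_sq {ι : Type*} [Fintype ι] {v : ι → ℂ}
    (h : ∑ x, ‖v x‖ ^ 2 = 1) : ∃ x, v x ≠ 0 := by
  by_contra! hv
  simp [hv] at h

theorem mulVec_mul_ne_zero {n : Type*} [Fintype n] [DecidableEq n] {M N : Matrix n n ℂ}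
    (hM : M ^ 2 = 1) (hN : N ^ 2 = 1) {ψ : n → ℂ} (hψ : ψ ≠ 0) : (M * N) *ᵥ ψ ≠ 0 := by
  intro h
  apply hψ
  have hinv : N * M * (M * N) = 1 := by
    rw [mul_assoc, ← mul_assoc M, ← sq, hM, one_mul, ← sq, hN]
  rw [← Matrix.one_mulVec ψ, ← hinv, ← Matrix.mulVec_mulVec, h, Matrix.mulVec_zero]

/-- core lemma for Theorem 2: three pairwise anticommuting
Hermitian involutions `U, V, W` supported on `{Q,A}`, `{Q,B}`, `{Q,C}`
respectively cannot map the product state `ψ = q ⊗ a ⊗ b ⊗ c` to states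
`U W ψ = q ⊗ φ_{AC} ⊗ b` and `V W ψ = q ⊗ a ⊗ φ_{BC}` that are unentangled
between `Q` and the rest. -/
theorem no_shared_localized_eigenstate
    {ιQ ιA ιB ιC : Type*} [Fintype ιQ] [Fintype ιA] [Fintype ιB] [Fintype ιC]
    [Nonempty ιQ] [Nonempty ιA] [Nonempty ιB] [Nonempty ιC]
    (qv : ιQ → ℂ) (av : ιA → ℂ) (bv : ιB → ℂ) (cv : ιC → ℂ)
    (hq : ∑ x, ‖qv x‖ ^ 2 = 1) (ha : ∑ x, ‖av x‖ ^ 2 = 1)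
    (hb : ∑ x, ‖bv x‖ ^ 2 = 1) (hc : ∑ x, ‖cv x‖ ^ 2 = 1)
    (U V W : Matrix (ιQ × ιA × ιB × ιC) (ιQ × ιA × ιB × ιC) ℂ)
    (hUsupp : SuppQA U) (hVsupp : SuppQB V) (hWsupp : SuppQC W)
    (hUH : U.IsHermitian) (hVH : V.IsHermitian) (hWH : W.IsHermitian)
    (hU2 : U ^ 2 = 1) (hV2 : V ^ 2 = 1) (hW2 : W ^ 2 = 1)
    (hUV : U * V = -(V * U)) (hUW : U * W = -(W * U)) (hVW : V * W = -(W * V)) :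
    ¬ ∃ (φAC : ιA × ιC → ℂ) (φBC : ιB × ιC → ℂ),
        (U * W).mulVec (fun p => qv p.1 * av p.2.1 * bv p.2.2.1 * cv p.2.2.2) =
          (fun p => qv p.1 * φAC (p.2.1, p.2.2.2) * bv p.2.2.1) ∧
        (V * W).mulVec (fun p => qv p.1 * av p.2.1 * bv p.2.2.1 * cv p.2.2.2) =
          (fun p => qv p.1 * av p.2.1 * φBC (p.2.2.1, p.2.2.2)) := by
  rintro ⟨φAC, φBC, hU, hV⟩
  obtain ⟨u, hu⟩ := hUsupp
  obtain ⟨v, hv⟩ := hVsupp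
  obtain ⟨w, hw⟩ := hWsupp
  obtain ⟨x₀, hx₀⟩ := exists_ne_zero_of_sum_norm_sq hq
  obtain ⟨a₀, ha₀⟩ := exists_ne_zero_of_sum_norm_sq ha
  obtain ⟨b₀, hb₀⟩ := exists_ne_zero_of_sum_norm_sq hb
  obtain ⟨c₀, hc₀⟩ := exists_ne_zero_of_sum_norm_sq hc
  have hψ : (fun p : ιQ × ιA × ιB × ιC => qv p.1 * av p.2.1 * bv p.2.2.1 * cv p.2.2.2) ≠ 0 :=
    fun h => mul_ne_zero (mul_ne_zero (mul_ne_zero hx₀ ha₀) hb₀) hc₀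
      (congrFun h (x₀, a₀, b₀, c₀))
  have huv := partialContraction_anticomm (u := u) (v := v) (fun x y a a' b b' => by
    have := congrFun₂ hUV (x, a, b, c₀) (y, a', b', c₀)
    simpa [Matrix.mul_apply, Fintype.sum_prod_type, hu, hv, ite_and] using this) av bv
  have huw := partialContraction_anticomm (u := u) (v := w) (fun x y a a' c c' => by
    have := congrFun₂ hUW (x, a, b₀, c) (y, a', b₀, c')
    simpa [Matrix.mul_apply, Fintype.sum_prod_type, hu, hw, ite_and] using this) av cv
  have hvw := partialContraction_anticomm (u := v) (v := w) (fun x y b b' c c' => by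
    have := congrFun₂ hVW (x, a₀, b, c) (y, a₀, b', c')
    simpa [Matrix.mul_apply, Fintype.sum_prod_type, hv, hw, ite_and] using this) bv cv
  have hWψ : W *ᵥ (fun p => qv p.1 * av p.2.1 * bv p.2.2.1 * cv p.2.2.2) =
      fun p => (partialContraction w cv p.2.2.2 *ᵥ qv) p.1 * av p.2.1 * bv p.2.2.1 := by
    ext ⟨x, a, b, c⟩
    simp only [partialContraction_mulVec, Finset.sum_mul]
    simp only [Matrix.mulVec, dotProduct, Fintype.sum_prod_type, hw, ite_and, mul_ite, ite_mul,
      mul_one, mul_zero, zero_mul, Finset.sum_ite_irrel, Finset.sum_const_zero,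
      Finset.sum_ite_eq, Finset.mem_univ, if_true]
    exact Finset.sum_congr rfl fun y _ => Finset.sum_congr rfl fun c' _ => by ring
  have hφ : ∀ a c, (partialContraction u av a * partialContraction w cv c) *ᵥ qv =
      φAC (a, c) • qv := by
    intro a c
    ext x
    have h := congrFun hU (x, a, b₀, c)
    rw [← Matrix.mulVec_mulVec, hWψ] at h
    simp only [Matrix.mulVec, dotProduct, Fintype.sum_prod_type, hu, ite_and, mul_ite, ite_mul,
      mul_one, mul_zero, zero_mul, Finset.sum_ite_irrel, Finset.sum_const_zero,
      Finset.sum_ite_eq, Finset.mem_univ, if_true] at h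
    apply mul_right_cancel₀ hb₀
    rw [← Matrix.mulVec_mulVec, partialContraction_mulVec, Pi.smul_apply, smul_eq_mul,
      mul_comm (φAC _), ← h]
    simp only [Finset.sum_mul, Matrix.mulVec, dotProduct, mul_assoc]
  have hχ : ∀ b c, (partialContraction v bv b * partialContraction w cv c) *ᵥ qv =
      φBC (b, c) • qv := by
    intro b c
    ext x
    have h := congrFun hV (x, a₀, b, c)
    rw [← Matrix.mulVec_mulVec, hWψ] at h
    simp only [Matrix.mulVec, dotProduct, Fintype.sum_prod_type, hv, ite_and, mul_ite, ite_mul,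
      mul_one, mul_zero, zero_mul, Finset.sum_ite_irrel, Finset.sum_const_zero,
      Finset.sum_ite_eq, Finset.mem_univ, if_true] at h
    apply mul_right_cancel₀ ha₀
    rw [← Matrix.mulVec_mulVec, partialContraction_mulVec, Pi.smul_apply, smul_eq_mul,
      mul_comm (φBC _), mul_right_comm, ← h]
    rw [Finset.sum_mul]
    refine Finset.sum_congr rfl fun y _ => ?_
    rw [Finset.sum_mul]
    refine Finset.sum_congr rfl fun b' _ => ?_
    simp only [Matrix.mulVec, dotProduct]
    ring
  have hqv : qv ≠ 0 := fun h => hx₀ (congrFun h x₀)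
  rcases eigenvalues_eq_zero_of_anticomm huv huw hvw hqv (φ := fun a c => φAC (a, c))
    (χ := fun b c => φBC (b, c)) hφ hχ with h | h
  · apply mulVec_mul_ne_zero hU2 hW2 hψ
    rw [hU]
    ext p
    simp [h]
  · apply mulVec_mul_ne_zero hV2 hW2 hψ
    rw [hV]
    ext p
    simp [h]
end

section
/- Let H_Q, H_A, H_B, H_C be finite-dimensional complex Hilbert spaces and let Ψ be a nonzero vector of H_Q ⊗ H_A ⊗ H_B ⊗ H_C. Suppose Ψ factorizes across the bipartition (QA | BC), i.e. Ψ is the image of x ⊗ y under the canonical isomorphism (H_Q ⊗ H_A) ⊗ (H_B ⊗ H_C) ≅ H_Q ⊗ H_A ⊗ H_B ⊗ H_C for some x ∈ H_Q ⊗ H_A and y ∈ H_B ⊗ H_C, and that Ψ also factorizes across the bipartition (QB | AC), i.e. Ψ is the image of z ⊗ w under the canonical isomorphism (H_Q ⊗ H_B) ⊗ (H_A ⊗ H_C) ≅ H_Q ⊗ H_A ⊗ H_B ⊗ H_C for some z ∈ H_Q ⊗ H_B and w ∈ H_A ⊗ H_C. Then Ψ is a fully product vector: there exist θ ∈ H_Q,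 α ∈ H_A, β ∈ H_B, γ ∈ H_C with Ψ = θ ⊗ α ⊗ β ⊗ γ. -/
/-- a nonzero vector of `H_Q ⊗ H_A ⊗ H_B ⊗ H_C` (finite-dimensional
complex Hilbert spaces, written in coordinates) that factorizes across the
bipartition `(QA | BC)` and also across the bipartition `(QB | AC)` must be a
fully product vector `θ ⊗ α ⊗ β ⊗ γ`. -/
theorem double_bipartite_factorization_is_product
    {ιQ ιA ιB ιC : Type*} [Fintype ιQ] [Fintype ιA] [Fintype ιB] [Fintype ιC]
    (Ψ : ιQ × ιA × ιB × ιC → ℂ) (hΨ : Ψ ≠ 0)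
    (hQA_BC : ∃ (x : ιQ × ιA → ℂ) (y : ιB × ιC → ℂ),
        ∀ p : ιQ × ιA × ιB × ιC, Ψ p = x (p.1, p.2.1) * y (p.2.2.1, p.2.2.2))
    (hQB_AC : ∃ (z : ιQ × ιB → ℂ) (w : ιA × ιC → ℂ),
        ∀ p : ιQ × ιA × ιB × ιC, Ψ p = z (p.1, p.2.2.1) * w (p.2.1, p.2.2.2)) :
    ∃ (θ : ιQ → ℂ) (α : ιA → ℂ) (β : ιB → ℂ) (γ : ιC → ℂ),
      ∀ p : ιQ × ιA × ιB × ιC, Ψ p = θ p.1 * α p.2.1 * β p.2.2.1 * γ p.2.2.2 := by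
  obtain ⟨x, y, hxy⟩ := hQA_BC
  obtain ⟨z, w, hzw⟩ := hQB_AC
  obtain ⟨⟨q₀, a₀, b₀, c₀⟩, hp⟩ := Function.ne_iff.mp hΨ
  rw [hxy] at hp
  have hx : x (q₀, a₀) ≠ 0 := left_ne_zero_of_mul hp
  have hy : y (b₀, c₀) ≠ 0 := right_ne_zero_of_mul hp
  refine ⟨fun q => z (q, b₀), fun a => w (a, c₀) / (x (q₀, a₀) * y (b₀, c₀)),
    fun b => z (q₀, b), fun c => w (a₀, c), ?_⟩
  rintro ⟨q, a, b, c⟩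
  have hqa : x (q, a) * y (b₀, c₀) = z (q, b₀) * w (a, c₀) :=
    (hxy (q, a, b₀, c₀)).symm.trans (hzw (q, a, b₀, c₀))
  have hbc : x (q₀, a₀) * y (b, c) = z (q₀, b) * w (a₀, c) :=
    (hxy (q₀, a₀, b, c)).symm.trans (hzw (q₀, a₀, b, c))
  rw [hxy]
  field_simp
  linear_combination x (q₀, a₀) * y (b, c) * hqa + z (q, b₀) * w (a, c₀) * hbc
end

section
/- No product states for overlapping cycles: Let G = (V,E) be a finite connected simple graph containing two distinct vertices u ≠ v joined by three paths that are pairwise vertex-disjoint except at their common endpoints u and v, each path having length at least 2 (i.e. G contains an 8-shaped subgraph consisting of two overlapping cycles). Then for every local block encoding of the fermionic modes on G, the code subspace C contains no nonzero product vector, i.e. no nonzero vector of the form ⊗_{v∈V} ψ_v. -/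
open scoped Classical

/-- A local block encoding of the fermionic modes on `G`: operators `B k`
supported on `{k}`, operators `A j k = - A k j` supported on `{j, k}` for edges
`(j, k)`, and a nonzero subspace `C` closed under all of them, on which all the
algebraic relations of the fermionic generators hold, including the loop
relation for every closed walk. -/
def IsLocalBlockEncoding {V : Type*} [Fintype V] [DecidableEq V]
    (G : SimpleGraph V) (d : V → ℕ)
    (A : V → V → Matrix (TIdx d) (TIdx d) ℂ)
    (B : V → Matrix (TIdx d) (TIdx d) ℂ)
    (C : Submodule ℂ (TIdx d → ℂ)) : Prop :=
  (∀ k, SupportedOn d {k} (B k)) ∧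
  (∀ j k, G.Adj j k → SupportedOn d {j, k} (A j k) ∧ A k j = - A j k) ∧
  C ≠ ⊥ ∧
  (∀ k, ∀ ψ ∈ C, (B k).mulVec ψ ∈ C) ∧
  (∀ j k, G.Adj j k → ∀ ψ ∈ C, (A j k).mulVec ψ ∈ C) ∧
  (∀ j k, ∀ ψ ∈ C, (B j * B k - B k * B j).mulVec ψ = 0) ∧
  (∀ j k l, G.Adj j k → ∀ ψ ∈ C,
      (A j k * B l - ((-1 : ℂ) ^ (kdelta j l + kdelta k l)) • (B l * A j k)).mulVec ψ
        = 0) ∧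
  (∀ j k l m, G.Adj j k → G.Adj l m → ∀ ψ ∈ C,
      (A j k * A l m -
        ((-1 : ℂ) ^ (kdelta j l + kdelta k l + kdelta j m + kdelta k m)) •
          (A l m * A j k)).mulVec ψ = 0) ∧
  (∀ j k, G.Adj j k → ∀ ψ ∈ C, ((A j k).conjTranspose - A j k).mulVec ψ = 0) ∧
  (∀ k, ∀ ψ ∈ C, ((B k).conjTranspose - B k).mulVec ψ = 0) ∧
  (∀ j k, G.Adj j k → ∀ ψ ∈ C, (A j k ^ 2).mulVec ψ = ψ) ∧
  (∀ k, ∀ ψ ∈ C, (B k ^ 2).mulVec ψ = ψ) ∧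
  (∀ (n : ℕ) (f : Fin (n + 1) → V), (∀ t, G.Adj (f t) (f (t + 1))) → ∀ ψ ∈ C,
      Complex.I ^ (n + 1) •
        ((List.ofFn (fun t : Fin (n + 1) => A (f t) (f (t + 1)))).prod).mulVec ψ
        = ψ)

/-- An operator supported on two sites acts by a kernel in the two corresponding coordinates. -/
theorem SupportedOn.exists_kernel {V : Type*} [Fintype V] [DecidableEq V] {d : V → ℕ}
    (hd : ∀ w, 0 < d w) {j k : V} (hjk : j ≠ k) {M : Matrix (TIdx d) (TIdx d) ℂ}
    (hM : SupportedOn d {j, k} M) :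
    ∃ K : Fin (d j) → Fin (d k) → Fin (d j) → Fin (d k) → ℂ, ∀ (φ : TIdx d → ℂ) (x : TIdx d),
      M.mulVec φ x = ∑ i, ∑ s, K (x j) (x k) i s *
        φ (Function.update (Function.update x j i) k s) := by
  obtain ⟨m, hm⟩ := hM
  let z : TIdx d := fun w => ⟨0, hd w⟩
  let e (x : TIdx d) (i : Fin (d j)) (s : Fin (d k)) : TIdx d :=
    Function.update (Function.update x j i) k s
  have e_j (x i s) : e x i s j = i := by simp [e, hjk]
  have e_k (x i s) : e x i s k = s := by simp [e]
  have e_off (x i s) (w : V) (hw : w ∉ ({j, k} : Set V)) : e x i s w = x w := by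
    simp only [Set.mem_insert_iff, Set.mem_singleton_iff, not_or] at hw
    simp [e, hw.1, hw.2]
  have restrict_eq {x y : TIdx d} (h₁ : x j = y j) (h₂ : x k = y k) :
      (fun w : ({j, k} : Set V) => x w.1) = fun w : ({j, k} : Set V) => y w.1 := by
    funext ⟨w, hw⟩
    rcases hw with rfl | hw
    · exact h₁
    · obtain rfl : w = k := hw
      exact h₂
  refine ⟨fun i s i' s' => M (e z i s) (e z i' s'), fun φ x => ?_⟩
  rw [← Fintype.sum_prod_type' (f := fun i s => M (e z (x j) (x k)) (e z i s) * φ (e x i s))]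
  refine (Fintype.sum_of_injective (fun t : Fin (d j) × Fin (d k) => e x t.1 t.2) ?_ _ _ ?_ ?_).symm
  · rintro ⟨i, s⟩ ⟨i', s'⟩ h
    have h₁ := congrFun h j
    have h₂ := congrFun h k
    simp only [e_j, e_k] at h₁ h₂
    rw [h₁, h₂]
  · intro y hy
    have hne : ¬ ∀ w ∉ ({j, k} : Set V), x w = y w := by
      intro h
      refine hy ⟨(y j, y k), ?_⟩
      funext w
      by_cases hw : w ∈ ({j, k} : Set V)
      · rcases hw with rfl | hw
        · exact e_j _ _ _
        · obtain rfl : w = k := hw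
          exact e_k _ _ _
      · exact (e_off _ _ _ _ hw).trans (h w hw)
    have hxy : M x y = 0 := by rw [hm, if_neg hne]
    exact mul_eq_zero_of_left hxy _
  · rintro ⟨i, s⟩
    simp only
    congr 1
    rw [hm, hm, if_pos, if_pos]
    · rw [restrict_eq (x := e z (x j) (x k)) (y := x) (e_j _ _ _) (e_k _ _ _),
        restrict_eq (x := e z i s) (y := e x i s) ((e_j _ _ _).trans (e_j _ _ _).symm)
          ((e_k _ _ _).trans (e_k _ _ _).symm)]
    · exact fun w hw => (e_off _ _ _ _ hw).symm
    · exact fun w hw => (e_off _ _ _ _ hw).trans (e_off _ _ _ _ hw).symm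

/-- The vector `φ` is of the form `χ ⊗ φ'` with `χ` at the site `u`
(in cross-multiplied form). -/
def FactorsAt {V : Type*} [DecidableEq V] {d : V → ℕ} (u : V) (χ : Fin (d u) → ℂ)
    (φ : TIdx d → ℂ) : Prop :=
  ∀ x t, χ t * φ x = χ (x u) * φ (Function.update x u t)

theorem FactorsAt.smul {V : Type*} [DecidableEq V] {d : V → ℕ} {u : V} {χ : Fin (d u) → ℂ}
    {φ : TIdx d → ℂ} (h : FactorsAt u χ φ) (c : ℂ) : FactorsAt u χ (c • φ) := by
  intro x t
  simp only [Pi.smul_apply, smul_eq_mul]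
  linear_combination c * h x t

theorem factorsAt_prod {V : Type*} [Fintype V] [DecidableEq V] {d : V → ℕ}
    (ψ : (w : V) → Fin (d w) → ℂ) (u : V) :
    FactorsAt u (ψ u) (fun x : TIdx d => ∏ w, ψ w (x w)) := by
  intro x t
  simp only
  rw [← Finset.mul_prod_erase Finset.univ (fun w => ψ w (x w)) (Finset.mem_univ u),
    ← Finset.mul_prod_erase Finset.univ (fun w => ψ w (Function.update x u t w))
      (Finset.mem_univ u)]
  have h : ∏ w ∈ Finset.univ.erase u, ψ w (Function.update x u t w) =
      ∏ w ∈ Finset.univ.erase u, ψ w (x w) :=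
    Finset.prod_congr rfl fun w hw => by rw [Function.update_of_ne (Finset.ne_of_mem_erase hw)]
  rw [h, Function.update_self]
  ring

/-- Operators supported away from `u` preserve the tensor factor at `u`. -/
theorem FactorsAt.mulVec {V : Type*} [Fintype V] [DecidableEq V] {d : V → ℕ}
    (hd : ∀ w, 0 < d w) {u j k : V} (hjk : j ≠ k) (hj : j ≠ u) (hk : k ≠ u)
    {M : Matrix (TIdx d) (TIdx d) ℂ} (hM : SupportedOn d {j, k} M)
    {χ : Fin (d u) → ℂ} {φ : TIdx d → ℂ} (h : FactorsAt u χ φ) :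
    FactorsAt u χ (M.mulVec φ) := by
  obtain ⟨K, hK⟩ := hM.exists_kernel hd hjk
  intro x t
  rw [hK, hK, Finset.mul_sum, Finset.mul_sum]
  refine Finset.sum_congr rfl fun i _ => ?_
  rw [Finset.mul_sum, Finset.mul_sum]
  refine Finset.sum_congr rfl fun s _ => ?_
  have h' := h (Function.update (Function.update x j i) k s) t
  rw [Function.update_of_ne hk.symm, Function.update_of_ne hj.symm,
    Function.update_comm hk, Function.update_comm hj] at h'
  rw [Function.update_of_ne hj, Function.update_of_ne hk]
  linear_combination K (x j) (x k) i s * h'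

/-- The product of the edge operators along a walk. -/
def walkOperator {V R : Type*} [Monoid R] {G : SimpleGraph V} (A : V → V → R) {a b : V}
    (w : G.Walk a b) : R :=
  (w.darts.map fun e => A e.fst e.snd).prod

theorem walkOperator_nil {V R : Type*} [Monoid R] {G : SimpleGraph V} (A : V → V → R) (a : V) :
    walkOperator A (SimpleGraph.Walk.nil : G.Walk a a) = 1 := rfl

theorem walkOperator_cons {V R : Type*} [Monoid R] {G : SimpleGraph V} (A : V → V → R)
    {a b c : V} (h : G.Adj a b) (w : G.Walk b c) :
    walkOperator A (SimpleGraph.Walk.cons h w) = A a b * walkOperator A w := rfl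

theorem walkOperator_append {V R : Type*} [Monoid R] {G : SimpleGraph V} (A : V → V → R)
    {a b c : V} (w : G.Walk a b) (w' : G.Walk b c) :
    walkOperator A (w.append w') = walkOperator A w * walkOperator A w' := by
  simp [walkOperator]

/-- The operator of a closed walk in terms of its cyclically indexed vertices. -/
theorem walkOperator_eq_prod_ofFn {V R : Type*} [Monoid R] {G : SimpleGraph V} (A : V → V → R)
    {a : V} (w : G.Walk a a) {n : ℕ} (hn : w.length = n + 1) :
    ∃ f : Fin (n + 1) → V, (∀ t, G.Adj (f t) (f (t + 1))) ∧
      walkOperator A w = (List.ofFn fun t => A (f t) (f (t + 1))).prod := by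
  have hsucc (t : Fin (n + 1)) : w.getVert (t + 1 : Fin (n + 1)) = w.getVert (t.1 + 1) := by
    by_cases ht : t = Fin.last n
    · subst ht
      have h := w.getVert_length
      rw [hn] at h
      rw [Fin.last_add_one, Fin.val_last, h, Fin.val_zero, w.getVert_zero]
    · rw [Fin.val_add_one_of_lt (Fin.lt_last_iff_ne_last.2 ht)]
  refine ⟨fun t => w.getVert t, fun t => ?_, ?_⟩
  · simp only [hsucc]
    exact w.adj_getVert_succ (by omega)
  · rw [walkOperator]
    congr 1
    refine List.ext_getElem (by simp [hn]) fun i h₁ h₂ => ?_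
    simp only [List.getElem_map, List.getElem_ofFn, hsucc]
    rw [SimpleGraph.Walk.darts_getElem_eq_getVert]

/-- A four-leg tensor product cannot be moved consistently by three operators sharing a leg
that satisfy the exchange relation of fermionic hopping at a junction. -/
theorem fermionic_junction_not_product {I S T R : Type*} [Fintype I] [Fintype S] [Fintype T]
    [Fintype R]
    (Ka : I → S → I → S → ℂ) (Kb : I → T → I → T → ℂ) (Kc : I → R → I → R → ℂ)
    (Xa Xb Xc : (I → S → T → R → ℂ) → I → S → T → R → ℂ)
    (hXa : ∀ θ i s t r, Xa θ i s t r = ∑ i', ∑ s', Ka i s i' s' * θ i' s' t r)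
    (hXb : ∀ θ i s t r, Xb θ i s t r = ∑ i', ∑ t', Kb i t i' t' * θ i' s t' r)
    (hXc : ∀ θ i s t r, Xc θ i s t r = ∑ i', ∑ r', Kc i r i' r' * θ i' s t r')
    (α : I → ℂ) (β : S → ℂ) (γ : T → ℂ) (δ : R → ℂ) (θ : I → S → T → R → ℂ)
    (hθ : ∀ i s t r, θ i s t r = α i * β s * γ t * δ r) (hθ0 : θ ≠ 0)
    (hexch : ∀ i s t r, Xa (Xb (Xc θ)) i s t r = -Xc (Xb (Xa θ)) i s t r)
    (F F' : S → T → R → ℂ) (hF : ∀ i s t r, Xb (Xc θ) i s t r = α i * F s t r)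
    (hF' : ∀ i s t r, Xb (Xa θ) i s t r = α i * F' s t r)
    (ha : Xa θ ≠ 0) (hbc : Xb (Xc θ) ≠ 0) : False := by
  obtain ⟨i₀, s₀, t₀, r₀, h₀⟩ : ∃ i s t r, θ i s t r ≠ 0 := by
    by_contra! h
    exact hθ0 (by funext i s t r; exact h i s t r)
  rw [hθ] at h₀
  simp only [mul_ne_zero_iff] at h₀
  obtain ⟨⟨⟨hα, hβ⟩, hγ⟩, hδ⟩ := h₀
  let χa (i : I) (s : S) : ℂ := ∑ i', ∑ s', Ka i s i' s' * (α i' * β s')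
  let χc (i : I) (r : R) : ℂ := ∑ i', ∑ r', Kc i r i' r' * (α i' * δ r')
  have hχa (i s t r) : Xa θ i s t r = χa i s * γ t * δ r := by
    simp only [hXa, hθ, χa, Finset.sum_mul]
    exact Finset.sum_congr rfl fun _ _ => Finset.sum_congr rfl fun _ _ => by ring
  have hχc (i s t r) : Xc θ i s t r = χc i r * β s * γ t := by
    simp only [hXc, hθ, χc, Finset.sum_mul]
    exact Finset.sum_congr rfl fun _ _ => Finset.sum_congr rfl fun _ _ => by ring
  let Y (e : I → ℂ) (i : I) (t : T) : ℂ := ∑ i', ∑ t', Kb i t i' t' * (e i' * γ t')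
  have hYc (i s t r) : Xb (Xc θ) i s t r = Y (fun i => χc i r) i t * β s := by
    simp only [hXb, hχc, Y, Finset.sum_mul]
    exact Finset.sum_congr rfl fun _ _ => Finset.sum_congr rfl fun _ _ => by ring
  have hYa (i s t r) : Xb (Xa θ) i s t r = Y (fun i => χa i s) i t * δ r := by
    simp only [hXb, hχa, Y, Finset.sum_mul]
    exact Finset.sum_congr rfl fun _ _ => Finset.sum_congr rfl fun _ _ => by ring
  let W (r : R) (t : T) : ℂ := F s₀ t r / β s₀
  let W' (s : S) (t : T) : ℂ := F' s t r₀ / δ r₀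
  have hW (i t r) : Y (fun i => χc i r) i t = α i * W r t := by
    have h := (hYc i s₀ t r).symm.trans (hF i s₀ t r)
    simp only [W]
    field_simp
    exact h
  have hW' (i s t) : Y (fun i => χa i s) i t = α i * W' s t := by
    have h := (hYa i s t r₀).symm.trans (hF' i s t r₀)
    simp only [W']
    field_simp
    exact h
  have hkey (i s t r) : χa i s * W r t = -(χc i r * W' s t) := by
    have h := hexch i s t r
    have h₁ : Xa (Xb (Xc θ)) i s t r = χa i s * W r t := by
      simp only [hXa (Xb (Xc θ)), hYc, hW, χa, Finset.sum_mul]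
      exact Finset.sum_congr rfl fun _ _ => Finset.sum_congr rfl fun _ _ => by ring
    have h₂ : Xc (Xb (Xa θ)) i s t r = χc i r * W' s t := by
      simp only [hXc (Xb (Xa θ)), hYa, hW', χc, Finset.sum_mul]
      exact Finset.sum_congr rfl fun _ _ => Finset.sum_congr rfl fun _ _ => by ring
    rw [← h₁, ← h₂, h]
  obtain ⟨r, t, hrt⟩ : ∃ r t, W r t ≠ 0 := by
    by_contra! h
    refine hbc ?_
    funext i s t r
    rw [hYc, hW, h, mul_zero, zero_mul]
    rfl
  have hprop (i s) : χa i s = -(W' s t / W r t) * χc i r := by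
    have h := hkey i s t r
    field_simp
    linear_combination h
  have hW'0 (s) : W' s t = 0 := by
    have h : Y (fun i => χa i s) i₀ t = -(W' s t / W r t) * Y (fun i => χc i r) i₀ t := by
      simp only [Y, hprop, Finset.mul_sum]
      exact Finset.sum_congr rfl fun _ _ => Finset.sum_congr rfl fun _ _ => by ring
    rw [hW, hW'] at h
    have h' : α i₀ * W' s t = -(α i₀ * W' s t) := h.trans (by field_simp)
    have h'' := self_eq_neg.1 h'
    exact (mul_eq_zero.1 h'').resolve_left hα
  refine ha ?_
  funext i s t' r'
  rw [hχa, hprop, hW'0]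
  simp

/-- No product vector satisfies the exchange relation of fermionic hopping for three edge
operators meeting at a site `u` whose pairwise products restore the factor at `u`, unless these
operators annihilate it. -/
theorem not_product_of_exchange {V : Type*} [Fintype V] [DecidableEq V] {d : V → ℕ}
    (hd : ∀ w, 0 < d w) {u a b c : V} (hua : u ≠ a) (hub : u ≠ b) (huc : u ≠ c)
    (hab : a ≠ b) (hac : a ≠ c) (hbc : b ≠ c) {Ma Mb Mc : Matrix (TIdx d) (TIdx d) ℂ}
    (hMa : SupportedOn d {u, a} Ma) (hMb : SupportedOn d {u, b} Mb)
    (hMc : SupportedOn d {u, c} Mc) (ψ : (w : V) → Fin (d w) → ℂ) {Ψ : TIdx d → ℂ}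
    (hΨ : Ψ = fun x => ∏ w, ψ w (x w))
    (hexch : Ma.mulVec (Mb.mulVec (Mc.mulVec Ψ)) = -Mc.mulVec (Mb.mulVec (Ma.mulVec Ψ)))
    (hFc : FactorsAt u (ψ u) (Mb.mulVec (Mc.mulVec Ψ)))
    (hFa : FactorsAt u (ψ u) (Mb.mulVec (Ma.mulVec Ψ)))
    (ha : Ma.mulVec Ψ ≠ 0) (hbc0 : Mb.mulVec (Mc.mulVec Ψ) ≠ 0) : False := by
  obtain ⟨Ka, hKa⟩ := hMa.exists_kernel hd hua
  obtain ⟨Kb, hKb⟩ := hMb.exists_kernel hd hub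
  obtain ⟨Kc, hKc⟩ := hMc.exists_kernel hd huc
  let rest : Finset V := Finset.univ \ {u, a, b, c}
  let ρ (x : TIdx d) : ℂ := ∏ w ∈ rest, ψ w (x w)
  have hρ (x : TIdx d) (j : V) (hj : j ∈ ({u, a, b, c} : Finset V)) (i : Fin (d j)) :
      ρ (Function.update x j i) = ρ x := by
    refine Finset.prod_congr rfl fun w hw => ?_
    rw [Function.update_of_ne]
    rintro rfl
    exact (Finset.mem_sdiff.1 hw).2 hj
  have hρu (x : TIdx d) (i) : ρ (Function.update x u i) = ρ x := hρ x u (by simp) i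
  have hρa (x : TIdx d) (i) : ρ (Function.update x a i) = ρ x := hρ x a (by simp) i
  have hρb (x : TIdx d) (i) : ρ (Function.update x b i) = ρ x := hρ x b (by simp) i
  have hρc (x : TIdx d) (i) : ρ (Function.update x c i) = ρ x := hρ x c (by simp) i
  let L (θ : Fin (d u) → Fin (d a) → Fin (d b) → Fin (d c) → ℂ) (x : TIdx d) : ℂ :=
    θ (x u) (x a) (x b) (x c) * ρ x
  let Xa (θ : Fin (d u) → Fin (d a) → Fin (d b) → Fin (d c) → ℂ) i s t r : ℂ :=
    ∑ i', ∑ s', Ka i s i' s' * θ i' s' t r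
  let Xb (θ : Fin (d u) → Fin (d a) → Fin (d b) → Fin (d c) → ℂ) i s t r : ℂ :=
    ∑ i', ∑ t', Kb i t i' t' * θ i' s t' r
  let Xc (θ : Fin (d u) → Fin (d a) → Fin (d b) → Fin (d c) → ℂ) i s t r : ℂ :=
    ∑ i', ∑ r', Kc i r i' r' * θ i' s t r'
  have hLa (θ) : Ma.mulVec (L θ) = L (Xa θ) := by
    funext x
    simp only [hKa, L, Xa, hρu, hρa, Finset.sum_mul, mul_assoc]
    simp [hua, hab.symm, hac.symm, hub.symm, huc.symm]
  have hLb (θ) : Mb.mulVec (L θ) = L (Xb θ) := by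
    funext x
    simp only [hKb, L, Xb, hρu, hρb, Finset.sum_mul, mul_assoc]
    simp [hub, hab, hbc.symm, hua.symm, huc.symm]
  have hLc (θ) : Mc.mulVec (L θ) = L (Xc θ) := by
    funext x
    simp only [hKc, L, Xc, hρu, hρc, Finset.sum_mul, mul_assoc]
    simp [huc, hac, hbc, hua.symm, hub.symm]
  let θ (i : Fin (d u)) (s : Fin (d a)) (t : Fin (d b)) (r : Fin (d c)) : ℂ :=
    ψ u i * ψ a s * ψ b t * ψ c r
  have hL : Ψ = L θ := by
    subst hΨ
    funext x
    simp only [L, θ, ρ, rest]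
    rw [← Finset.prod_sdiff (Finset.subset_univ ({u, a, b, c} : Finset V)), mul_comm,
      Finset.prod_insert (by simp [hua, hub, huc]), Finset.prod_insert (by simp [hab, hac]),
      Finset.prod_insert (by simp [hbc]), Finset.prod_singleton]
    ring
  have hL0 : L 0 = 0 := by
    funext x
    simp [L]
  have hθ0 : θ ≠ 0 := by
    intro h
    rw [hL, h, hL0, Matrix.mulVec_zero] at ha
    exact ha rfl
  rw [hL] at hexch hFc hFa ha hbc0
  simp only [hLa, hLb, hLc] at hexch hFc hFa ha hbc0
  obtain ⟨z, hz⟩ : ∃ z, ρ z ≠ 0 := by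
    by_contra! h
    refine ha ?_
    funext x
    simp [L, h]
  let e i s t r : TIdx d :=
    Function.update (Function.update (Function.update (Function.update z u i) a s) b t) c r
  have hLe (η i s t r) : L η (e i s t r) = η i s t r * ρ z := by
    simp only [L, e, hρu, hρa, hρb, hρc]
    simp [hua, hub, huc, hab, hac, hbc]
  obtain ⟨i₀, hi₀⟩ : ∃ i, ψ u i ≠ 0 := by
    by_contra! h
    refine hθ0 ?_
    funext i s t r
    simp [θ, h]
  have hfactor (η) (hη : FactorsAt u (ψ u) (L η)) (i s t r) :
      η i s t r = ψ u i * (η i₀ s t r / ψ u i₀) := by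
    have h := hη (e i s t r) i₀
    have heu : e i s t r u = i := by simp [e, hua, hub, huc]
    have hupd : Function.update (e i s t r) u i₀ = e i₀ s t r := by
      simp only [e]
      rw [Function.update_comm huc.symm, Function.update_comm hub.symm,
        Function.update_comm hua.symm, Function.update_idem]
    rw [heu, hupd, hLe, hLe] at h
    field_simp
    exact mul_right_cancel₀ hz (by linear_combination h)
  refine fermionic_junction_not_product Ka Kb Kc Xa Xb Xc (fun _ _ _ _ _ => rfl)
    (fun _ _ _ _ _ => rfl) (fun _ _ _ _ _ => rfl) (ψ u) (ψ a) (ψ b) (ψ c) θ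
    (fun _ _ _ _ => rfl) hθ0 (fun i s t r => ?_) _ _ (hfactor _ hFc) (hfactor _ hFa)
    (fun h => ha (by rw [h, hL0])) (fun h => hbc0 (by rw [h, hL0]))
  have h := congrFun hexch (e i s t r)
  rw [Pi.neg_apply, hLe, hLe] at h
  exact mul_right_cancel₀ hz (by linear_combination h)

namespace IsLocalBlockEncoding

variable {V : Type*} [Fintype V] [DecidableEq V] {G : SimpleGraph V} {d : V → ℕ}
  {A : V → V → Matrix (TIdx d) (TIdx d) ℂ} {B : V → Matrix (TIdx d) (TIdx d) ℂ}
  {C : Submodule ℂ (TIdx d → ℂ)}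

theorem supportedOn_edge (h : IsLocalBlockEncoding G d A B C) {j k : V} (hjk : G.Adj j k) :
    SupportedOn d {j, k} (A j k) :=
  (h.2.1 j k hjk).1

theorem edge_swap (h : IsLocalBlockEncoding G d A B C) {j k : V} (hjk : G.Adj j k) :
    A k j = -A j k :=
  (h.2.1 j k hjk).2

theorem edge_mem (h : IsLocalBlockEncoding G d A B C) {j k : V} (hjk : G.Adj j k)
    {φ : TIdx d → ℂ} (hφ : φ ∈ C) : (A j k).mulVec φ ∈ C := by
  obtain ⟨-, -, -, -, hmem, -⟩ := h
  exact hmem j k hjk φ hφ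

theorem edge_edge (h : IsLocalBlockEncoding G d A B C) {j k : V} (hjk : G.Adj j k)
    {φ : TIdx d → ℂ} (hφ : φ ∈ C) : (A j k).mulVec ((A j k).mulVec φ) = φ := by
  obtain ⟨-, -, -, -, -, -, -, -, -, -, hsq, -⟩ := h
  rw [Matrix.mulVec_mulVec, ← sq, hsq j k hjk φ hφ]

theorem edge_anticomm (h : IsLocalBlockEncoding G d A B C) {u a b : V} (hua : G.Adj u a)
    (hub : G.Adj u b) (hab : a ≠ b) {φ : TIdx d → ℂ} (hφ : φ ∈ C) :
    (A u a).mulVec ((A u b).mulVec φ) = -(A u b).mulVec ((A u a).mulVec φ) := by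
  obtain ⟨-, -, -, -, -, -, -, hcomm, -⟩ := h
  have h := hcomm u a u b hua hub φ hφ
  simp only [kdelta, hua.ne', hub.ne, hab, if_true, if_false, add_zero, pow_one, neg_smul,
    one_smul, sub_neg_eq_add, Matrix.add_mulVec] at h
  rw [Matrix.mulVec_mulVec, Matrix.mulVec_mulVec]
  exact eq_neg_of_add_eq_zero_left h

theorem walkOperator_mem (h : IsLocalBlockEncoding G d A B C) {a b : V} (w : G.Walk a b)
    {φ : TIdx d → ℂ} (hφ : φ ∈ C) : (walkOperator A w).mulVec φ ∈ C := by
  induction w with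
  | nil => rwa [walkOperator_nil, Matrix.one_mulVec]
  | cons hadj w ih =>
    rw [walkOperator_cons, ← Matrix.mulVec_mulVec]
    exact h.edge_mem hadj ih

theorem loop (h : IsLocalBlockEncoding G d A B C) {a : V} (w : G.Walk a a)
    {φ : TIdx d → ℂ} (hφ : φ ∈ C) : Complex.I ^ w.length • (walkOperator A w).mulVec φ = φ := by
  obtain ⟨-, -, -, -, -, -, -, -, -, -, -, -, hloop⟩ := h
  rcases hn : w.length with _ | n
  · obtain rfl := (SimpleGraph.Walk.length_eq_zero_iff.1 hn).eq_nil
    simp [walkOperator_nil]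
  · obtain ⟨f, hf, hprod⟩ := walkOperator_eq_prod_ofFn A w hn
    rw [hprod]
    exact hloop n f hf φ hφ

/-- The operator of a walk avoiding `u` reflects the tensor factor at `u`. -/
theorem factorsAt_of_walkOperator (h : IsLocalBlockEncoding G d A B C) (hd : ∀ w, 0 < d w)
    {u a b : V} (w : G.Walk a b) (hw : u ∉ w.support) {χ : Fin (d u) → ℂ} {φ : TIdx d → ℂ}
    (hφ : φ ∈ C) (hfac : FactorsAt u χ ((walkOperator A w).mulVec φ)) : FactorsAt u χ φ := by
  induction w with
  | nil => rwa [walkOperator_nil, Matrix.one_mulVec] at hfac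
  | cons hadj w ih =>
    rw [SimpleGraph.Walk.support_cons, List.mem_cons, not_or] at hw
    refine ih hw.2 ?_
    rw [walkOperator_cons, ← Matrix.mulVec_mulVec] at hfac
    rw [← h.edge_edge hadj (h.walkOperator_mem w hφ)]
    refine hfac.mulVec hd hadj.ne (Ne.symm hw.1) ?_ (h.supportedOn_edge hadj)
    rintro rfl
    exact hw.2 w.start_mem_support

/-- If two neighbours of `u` are joined by a walk avoiding `u`, hopping between them through `u`
preserves the tensor factor at `u` of a code vector. -/
theorem factorsAt_edge_edge (h : IsLocalBlockEncoding G d A B C) (hd : ∀ w, 0 < d w)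
    {u a b : V} (hua : G.Adj u a) (hub : G.Adj u b) (w : G.Walk a b) (hw : u ∉ w.support)
    {χ : Fin (d u) → ℂ} {φ : TIdx d → ℂ} (hφ : φ ∈ C) (hfac : FactorsAt u χ φ) :
    FactorsAt u χ ((A u b).mulVec ((A u a).mulVec φ)) := by
  refine h.factorsAt_of_walkOperator hd w hw (h.edge_mem hub (h.edge_mem hua hφ)) ?_
  let W : G.Walk a a := w.append (.cons hub.symm (.cons hua .nil))
  have hloop := h.loop W hφ
  have hW : (walkOperator A W).mulVec φ =
      -(walkOperator A w).mulVec ((A u b).mulVec ((A u a).mulVec φ)) := by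
    simp only [W, walkOperator_append, walkOperator_cons, walkOperator_nil, mul_one,
      h.edge_swap hub, neg_mul, mul_neg, Matrix.neg_mulVec, Matrix.mulVec_mulVec]
  have hI : Complex.I ^ W.length ≠ 0 := pow_ne_zero _ Complex.I_ne_zero
  have heq : (walkOperator A w).mulVec ((A u b).mulVec ((A u a).mulVec φ)) =
      (-(Complex.I ^ W.length)⁻¹) • φ := by
    rw [neg_smul, ← neg_eq_iff_eq_neg, ← hW, eq_inv_smul_iff₀ hI]
    exact hloop
  rw [heq]
  exact hfac.smul _

end IsLocalBlockEncoding

/-- The first steps of two internally disjoint paths, one of length at least two, differ. -/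
theorem SimpleGraph.Walk.snd_ne_of_internally_disjoint {V : Type*} {G : SimpleGraph V}
    {u v a b : V} {hua : G.Adj u a} {hub : G.Adj u b} {p : G.Walk a v} {q : G.Walk b v}
    (hp : (cons hua p).IsPath) (hpl : 2 ≤ (cons hua p).length)
    (hpq : ∀ x, x ∈ (cons hua p).support → x ∈ (cons hub q).support → x = u ∨ x = v) :
    a ≠ b := by
  rintro rfl
  rcases hpq a (by simp) (by simp) with h | rfl
  · exact hua.ne' h
  · obtain rfl := (isPath_iff_nil.1 ((cons_isPath_iff _ _).1 hp).1).eq_nil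
    simp at hpl

/-- no product states for overlapping cycles: if a finite
connected simple graph `G` contains two distinct vertices `u ≠ v` joined by
three paths of length at least `2` that are pairwise vertex-disjoint except at
the common endpoints (an 8-shaped subgraph), then the code subspace `C` of any
local block encoding of the fermionic modes on `G` contains no nonzero product
vector. -/
theorem no_product_vector_in_code_space {V : Type*} [Fintype V] [DecidableEq V]
    (G : SimpleGraph V) (hG : G.Connected)
    (u v : V) (huv : u ≠ v)
    (p q r : G.Walk u v)
    (hp : p.IsPath) (hq : q.IsPath) (hr : r.IsPath)
    (hpl : 2 ≤ p.length) (hql : 2 ≤ q.length) (hrl : 2 ≤ r.length)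
    (hpq : ∀ x, x ∈ p.support → x ∈ q.support → x = u ∨ x = v)
    (hpr : ∀ x, x ∈ p.support → x ∈ r.support → x = u ∨ x = v)
    (hqr : ∀ x, x ∈ q.support → x ∈ r.support → x = u ∨ x = v)
    (d : V → ℕ) (hd : ∀ w, 0 < d w)
    (A : V → V → Matrix (TIdx d) (TIdx d) ℂ)
    (B : V → Matrix (TIdx d) (TIdx d) ℂ)
    (C : Submodule ℂ (TIdx d → ℂ))
    (henc : IsLocalBlockEncoding G d A B C) :
    ∀ ψ : (w : V) → (Fin (d w) → ℂ),
      (fun x : TIdx d => ∏ w, ψ w (x w)) ∈ C →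
      (fun x : TIdx d => ∏ w, ψ w (x w)) = 0 := by
  intro ψ hψ
  by_contra hne
  match p, q, r with
  | .nil, _, _ | _, .nil, _ | _, _, .nil => exact huv rfl
  | .cons (v := a) hua p, .cons (v := b) hub q, .cons (v := c) huc r =>
    have hab : a ≠ b := SimpleGraph.Walk.snd_ne_of_internally_disjoint hp hpl hpq
    have hac : a ≠ c := SimpleGraph.Walk.snd_ne_of_internally_disjoint hp hpl hpr
    have hbc : b ≠ c := SimpleGraph.Walk.snd_ne_of_internally_disjoint hq hql hqr
    have hup := ((SimpleGraph.Walk.cons_isPath_iff _ _).1 hp).2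
    have huq := ((SimpleGraph.Walk.cons_isPath_iff _ _).1 hq).2
    have hur := ((SimpleGraph.Walk.cons_isPath_iff _ _).1 hr).2
    have hedge_ne {j k : V} (hjk : G.Adj j k) {φ : TIdx d → ℂ} (hφ : φ ∈ C) (hφ0 : φ ≠ 0) :
        (A j k).mulVec φ ≠ 0 := by
      intro h0
      refine hφ0 ?_
      rw [← henc.edge_edge hjk hφ, h0, Matrix.mulVec_zero]
    refine not_product_of_exchange hd hua.ne hub.ne huc.ne hab hac hbc
      (henc.supportedOn_edge hua) (henc.supportedOn_edge hub) (henc.supportedOn_edge huc) ψ rfl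
      ?_ ?_ ?_ (hedge_ne hua hψ hne)
      (hedge_ne hub (henc.edge_mem huc hψ) (hedge_ne huc hψ hne))
    · rw [henc.edge_anticomm hua hub hab (henc.edge_mem huc hψ),
        henc.edge_anticomm hua huc hac hψ, Matrix.mulVec_neg, neg_neg,
        henc.edge_anticomm hub huc hbc (henc.edge_mem hua hψ)]
    · exact henc.factorsAt_edge_edge hd huc hub (r.append q.reverse)
        (by simp [SimpleGraph.Walk.mem_support_append_iff, hur, huq]) hψ (factorsAt_prod ψ u)
    · exact henc.factorsAt_edge_edge hd hua hub (p.append q.reverse)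
        (by simp [SimpleGraph.Walk.mem_support_append_iff, hup, huq]) hψ (factorsAt_prod ψ u)
end

section
/- Let N ≥ 3 and consider the Hilbert space of N+1 qubits labelled 1̄, 1, 2, …, N, i.e. H = (ℂ²)^{⊗(N+1)}. Let X_k, Y_k, Z_k denote the Pauli operators acting on qubit k (tensored with identity elsewhere). Define Â_{k,k+1} = X_k Y_{k+1} for k = 1, …, N−1 and Â_{N,1} = − X_N Y_1 Z_{1̄}. Then i^N Â_{1,2} Â_{2,3} ⋯ Â_{N−1,N} Â_{N,1} = Z_{1̄} Z_1 Z_2 ⋯ Z_N, i.e. the loop operator around the ring equals the global parity operator on all N+1 qubits. -/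
open scoped Classical

/-- The Pauli matrix `X`. -/
def PauliX : Matrix (Fin 2) (Fin 2) ℂ := !![0, 1; 1, 0]

/-- The Pauli matrix `Y`. -/
def PauliY : Matrix (Fin 2) (Fin 2) ℂ := !![0, -Complex.I; Complex.I, 0]

/-- The Pauli matrix `Z`. -/
def PauliZ : Matrix (Fin 2) (Fin 2) ℂ := !![1, 0; 0, -1]

/-- The operator on a register of qubits labelled by `ι` acting as the one-qubit
operator `m` on the qubit `k` and as the identity on all other qubits. -/
def localOp {ι : Type*} [Fintype ι] [DecidableEq ι] (k : ι)
    (m : Matrix (Fin 2) (Fin 2) ℂ) :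
    Matrix (ι → Fin 2) (ι → Fin 2) ℂ :=
  fun x y => m (x k) (y k) * if ∀ v ≠ k, x v = y v then 1 else 0

theorem localOp_mul_apply {ι : Type*} [Fintype ι] [DecidableEq ι] (k : ι)
    (m : Matrix (Fin 2) (Fin 2) ℂ) (A : Matrix (ι → Fin 2) (ι → Fin 2) ℂ) (x y : ι → Fin 2) :
    (localOp k m * A) x y = ∑ b, m (x k) b * A (Function.update x k b) y := by
  rw [Matrix.mul_apply]
  symm
  apply Finset.sum_of_injOn (fun b => Function.update x k b)
  · exact (Function.update_injective x k).injOn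
  · simp
  · intro w _ hw
    have : ¬ ∀ v ≠ k, x v = w v := by
      intro h
      refine hw ⟨w k, by simp, ?_⟩
      funext v
      by_cases hv : v = k
      · subst hv; simp
      · simp [hv, h v hv]
    simp [localOp, this]
  · intro b _
    have : ∀ v ≠ k, x v = Function.update x k b v := fun v hv => by simp [hv]
    simp only [localOp, if_pos this, Function.update_self, mul_one]

theorem localOp_mul_localOp {ι : Type*} [Fintype ι] [DecidableEq ι] (k : ι)
    (m m' : Matrix (Fin 2) (Fin 2) ℂ) :
    localOp k m * localOp k m' = localOp k (m * m') := by
  ext x y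
  have h (b : Fin 2) : (∀ v ≠ k, Function.update x k b v = y v) ↔ ∀ v ≠ k, x v = y v :=
    forall₂_congr fun v hv => by simp [hv]
  rw [localOp_mul_apply]
  simp only [localOp, h, Function.update_self, Matrix.mul_apply, Finset.sum_mul, mul_assoc]

theorem localOp_smul {ι : Type*} [Fintype ι] [DecidableEq ι] (k : ι) (c : ℂ)
    (m : Matrix (Fin 2) (Fin 2) ℂ) : localOp k (c • m) = c • localOp k m := by
  ext x y
  simp [localOp]

theorem localOp_mul_localOp_apply_of_ne {ι : Type*} [Fintype ι] [DecidableEq ι] {k l : ι}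
    (hkl : k ≠ l) (m m' : Matrix (Fin 2) (Fin 2) ℂ) (x y : ι → Fin 2) :
    (localOp k m * localOp l m') x y =
      m (x k) (y k) * m' (x l) (y l) * if ∀ v, v ≠ k → v ≠ l → x v = y v then 1 else 0 := by
  have h (b : Fin 2) : (∀ v ≠ l, Function.update x k b v = y v) ↔
      b = y k ∧ ∀ v, v ≠ k → v ≠ l → x v = y v := by
    constructor
    · intro h
      exact ⟨by simpa using h k hkl, fun v hk hl => by simpa [hk] using h v hl⟩
    · rintro ⟨rfl, h⟩ v hl
      by_cases hk : v = k
      · subst hk; simp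
      · simp [hk, h v hk hl]
  rw [localOp_mul_apply]
  simp only [localOp, h, Function.update_of_ne hkl.symm, ite_and]
  simp

theorem commute_localOp {ι : Type*} [Fintype ι] [DecidableEq ι] {k l : ι}
    (hkl : k ≠ l) (m m' : Matrix (Fin 2) (Fin 2) ℂ) :
    Commute (localOp k m) (localOp l m') := by
  ext x y
  rw [localOp_mul_localOp_apply_of_ne hkl, localOp_mul_localOp_apply_of_ne hkl.symm,
    mul_comm (m _ _)]
  congr 2
  exact propext (forall_congr' fun v => ⟨fun h a b => h b a, fun h a b => h b a⟩)

theorem PauliX_mul_PauliY : PauliX * PauliY = Complex.I • PauliZ := by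
  ext i j
  fin_cases i <;> fin_cases j <;> simp [PauliX, PauliY, PauliZ]

theorem PauliY_mul_PauliX : PauliY * PauliX = (-Complex.I) • PauliZ := by
  ext i j
  fin_cases i <;> fin_cases j <;> simp [PauliX, PauliY, PauliZ]

/-- A chain of bond operators `x k * y (k + 1)` telescopes when each `y k * x k` is a multiple
of `z k`. -/
theorem prod_chain_eq_smul {R : Type*} [Ring R] [Algebra ℂ R] (c : ℂ) (x y z : ℕ → R)
    (hyx : ∀ k, y k * x k = c • z k) (n : ℕ) :
    ((List.range (n + 1)).map fun k => x k * y (k + 1)).prod =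
      c ^ n • (x 0 * ((List.range n).map fun k => z (k + 1)).prod * y (n + 1)) := by
  induction n with
  | zero => simp
  | succ n ih =>
    rw [List.prod_range_succ, ih, List.prod_range_succ (fun k => z (k + 1)), pow_succ, mul_smul]
    have h := hyx (n + 1)
    simp only [smul_mul_assoc, mul_assoc]
    rw [← mul_assoc (y (n + 1)), h]
    simp only [smul_mul_assoc, mul_smul_comm]

theorem ofFn_eq_map_range {α : Type*} {n : ℕ} (f : Fin n → α) (g : ℕ → α)
    (h : ∀ i : Fin n, f i = g i) : List.ofFn f = (List.range n).map g := by
  apply List.ext_getElem <;> simp [h]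

/-- on `N + 1` qubits labelled `1̄ = none` and `1, …, N`
(`some 0, …, some (N-1)`), with `Â_{k,k+1} = X_k Y_{k+1}` for `k = 1, …, N-1`
and `Â_{N,1} = -X_N Y_1 Z_{1̄}`, the loop operator
`i^N Â_{1,2} Â_{2,3} ⋯ Â_{N-1,N} Â_{N,1}` equals the global parity operator
`Z_{1̄} Z_1 Z_2 ⋯ Z_N`. -/
theorem ring_loop_operator_eq_global_parity (N : ℕ) (hN : 3 ≤ N) [NeZero N] :
    Complex.I ^ N •
      (List.ofFn (fun t : Fin N =>
        if (t : ℕ) = N - 1 then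
          -(localOp (some t) PauliX * localOp (some (0 : Fin N)) PauliY *
              localOp (none : Option (Fin N)) PauliZ)
        else
          localOp (some t) PauliX * localOp (some (t + 1)) PauliY)).prod
    = localOp (none : Option (Fin N)) PauliZ *
        (List.ofFn (fun k : Fin N => localOp (some k) PauliZ)).prod := by
  obtain ⟨n, rfl⟩ : ∃ n, N = n + 2 := ⟨N - 2, by omega⟩
  let site : ℕ → Option (Fin (n + 2)) := fun k => some (Fin.ofNat (n + 2) k)
  let x : ℕ → Matrix (Option (Fin (n + 2)) → Fin 2) (Option (Fin (n + 2)) → Fin 2) ℂ :=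
    fun k => localOp (site k) PauliX
  let y : ℕ → Matrix (Option (Fin (n + 2)) → Fin 2) (Option (Fin (n + 2)) → Fin 2) ℂ :=
    fun k => localOp (site k) PauliY
  let z : ℕ → Matrix (Option (Fin (n + 2)) → Fin 2) (Option (Fin (n + 2)) → Fin 2) ℂ :=
    fun k => localOp (site k) PauliZ
  let w := localOp (none : Option (Fin (n + 2))) PauliZ
  have site_val (i : Fin (n + 2)) : some i = site i := by simp [site]
  have site_succ (i : Fin (n + 2)) : some (i + 1) = site (i + 1) := by
    simp only [site, Option.some.injEq]
    ext
    simp [Fin.val_add]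
  have hyx (k : ℕ) : y k * x k = (-Complex.I) • z k := by
    rw [localOp_mul_localOp, PauliY_mul_PauliX, localOp_smul]
  have hxy : x 0 * y 0 = Complex.I • z 0 := by
    rw [localOp_mul_localOp, PauliX_mul_PauliY, localOp_smul]
  have hL : List.ofFn (fun t : Fin (n + 2) =>
        if (t : ℕ) = n + 2 - 1 then
          -(localOp (some t) PauliX * localOp (some (0 : Fin (n + 2))) PauliY *
              localOp (none : Option (Fin (n + 2))) PauliZ)
        else
          localOp (some t) PauliX * localOp (some (t + 1)) PauliY) =
      (List.range (n + 2)).map fun k =>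
        if k = n + 1 then -(x k * y 0 * w) else x k * y (k + 1) := by
    apply ofFn_eq_map_range
    intro i
    rw [site_succ, site_val i, site_val 0]
    rfl
  have hR : List.ofFn (fun k : Fin (n + 2) => localOp (some k) PauliZ) =
      (List.range (n + 2)).map z :=
    ofFn_eq_map_range _ _ fun i => by rw [site_val i]
  have hchain : ((List.range (n + 1)).map fun k =>
      if k = n + 1 then -(x k * y 0 * w) else x k * y (k + 1)) =
      (List.range (n + 1)).map fun k => x k * y (k + 1) := by
    apply List.map_congr_left
    intro k hk
    rw [if_neg (List.mem_range.mp hk).ne]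
  let q := ((List.range (n + 1)).map fun k => z (k + 1)).prod
  have hq : Commute q (y 0) := by
    apply Commute.list_prod_left
    intro a ha
    obtain ⟨k, hk, rfl⟩ := List.mem_map.mp ha
    apply commute_localOp
    have hk' := List.mem_range.mp hk
    intro h
    have h' := congrArg Fin.val (Option.some.inj h)
    simp only [Fin.val_ofNat, Nat.zero_mod] at h'
    rw [Nat.mod_eq_of_lt (by omega)] at h'
    omega
  have hw : Commute w (z 0 * q) := by
    have hz (k : ℕ) : Commute w (z k) := commute_localOp (by simp [site]) _ _
    apply (hz 0).mul_right
    apply Commute.list_prod_right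
    intro a ha
    obtain ⟨k, -, rfl⟩ := List.mem_map.mp ha
    exact hz _
  have hqs : ((List.range n).map fun k => z (k + 1)).prod * z (n + 1) = q :=
    (List.prod_range_succ _ n).symm
  have hone : Complex.I ^ (n + 2) * (-((-Complex.I) ^ (n + 1) * Complex.I)) = 1 := by
    have : Complex.I ^ (n + 2) * (-((-Complex.I) ^ (n + 1) * Complex.I)) =
        (Complex.I * -Complex.I) ^ (n + 2) := by rw [mul_pow]; ring
    rw [this]; simp
  have hloop : x 0 * ((List.range n).map fun k => z (k + 1)).prod * y (n + 1) *
      (x (n + 1) * y 0 * w) = (-Complex.I * Complex.I) • (w * (z 0 * q)) := by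
    calc _ = x 0 * ((List.range n).map fun k => z (k + 1)).prod * (y (n + 1) * x (n + 1)) *
          y 0 * w := by simp only [mul_assoc]
      _ = (-Complex.I) • (x 0 * (q * y 0) * w) := by
        rw [hyx, ← hqs]; simp only [mul_smul_comm, smul_mul_assoc, mul_assoc]
      _ = (-Complex.I) • ((x 0 * y 0) * q * w) := by rw [hq.eq]; simp only [mul_assoc]
      _ = _ := by rw [hxy, hw.eq, mul_smul]; simp only [smul_mul_assoc]
  rw [hL, hR, List.prod_range_succ, hchain, prod_chain_eq_smul _ x y z hyx, if_pos rfl,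
    List.prod_range_succ', mul_neg, smul_mul_assoc, hloop, ← smul_neg, ← neg_smul, smul_smul,
    smul_smul]
  convert one_smul ℂ _ using 2
  rw [← hone]
  ring
end
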